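/- Main theorem (product source, separable cost): Let c be lower semicontinuous, bounded from below and separable, c(x,y) = Σ_{t≤N} c_t(x_t,y_t), and suppose μ is the product of its one-dimensional marginals, μ = μ₁ ⊗ ⋯ ⊗ μ_N. Then inf_{γ ∈ Π_c(μ,ν)} ∫ c dγ = inf_{γ ∈ Π_bc(μ,ν)} ∫ c dγ. If moreover c_t(x,y) = c_t(x − y) with c_t convex, then the Knothe–Rosenblatt rearrangement of (μ,ν) solves the causal problem (Pc); and if additionally each μ_i is atomless, this rearrangement is induced by the Knothe–Rosenblatt Monge map. -/

import Mathlib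

open MeasureTheory ProbabilityTheory Set Filter
open scoped ENNReal NNReal BoundedContinuousFunction

noncomputable section

namespace CausalTransport

/-- The path space of a real-valued process in `N` time steps. -/
abbrev Path (N : ℕ) := Fin N → ℝ

/-- Truncation of a path to its first `t` coordinates. -/
def proj (N t : ℕ) (x : Path N) : Fin t → ℝ :=
  fun i => if h : (i : ℕ) < N then x ⟨i, h⟩ else 0

/-- The coordinate with (0-based) index `t`, with junk value `0` if `t ≥ N`. -/
def coord (N t : ℕ) (x : Path N) : ℝ := if h : t < N then x ⟨t, h⟩ else 0

/-- The coordinates of a path after time `t`. -/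
def tailProj (N t : ℕ) (x : Path N) : Fin (N - t) → ℝ := fun i => coord N (t + i) x

/-- Extension of a history of length `t` by one further value. -/
def snocFun (t : ℕ) (xs : Fin t → ℝ) (r : ℝ) : Fin (t + 1) → ℝ :=
  fun i => if h : (i : ℕ) < t then xs ⟨i, h⟩ else r

/-- Extension of a history of length `t` to a full path (by `0`). -/
def pad (N t : ℕ) (xs : Fin t → ℝ) : Path N :=
  fun i => if h : (i : ℕ) < t then xs ⟨i, h⟩ else 0

/-- Glue the first `t` coordinates of `x` with the later coordinates `z`. -/
def glue (N t : ℕ) (x : Path N) (z : Fin (N - t) → ℝ) : Path N :=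
  fun i => if (i : ℕ) < t then x i else
    if h : (i : ℕ) - t < N - t then z ⟨(i : ℕ) - t, h⟩ else 0

/-- Truncation of a pair of paths to the first `t` coordinates of each. -/
def pairProj (N t : ℕ) (p : Path N × Path N) : (Fin t → ℝ) × (Fin t → ℝ) :=
  (proj N t p.1, proj N t p.2)

/-- The σ-algebra on path space generated by the first `t` coordinates. -/
def filt (N t : ℕ) : MeasurableSpace (Path N) :=
  MeasurableSpace.comap (proj N t) inferInstance

/-- `γ` is a transport plan (coupling) between `μ` and `ν`. -/
def IsCoupling {α β : Type*} [MeasurableSpace α] [MeasurableSpace β]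
    (μ : Measure α) (ν : Measure β) (γ : Measure (α × β)) : Prop :=
  γ.map Prod.fst = μ ∧ γ.map Prod.snd = ν

/-- `γ` is a causal transport plan between `μ` and `ν`: it is a coupling and, for any
disintegration `K` of `γ` over its first coordinate and any `t ∈ {1,…,N}`, the map
`x ↦ K x B` is measurable for the σ-algebra of the first `t` coordinates (up to `μ`-null
sets) whenever `B` is measurable for the first `t` coordinates. -/
def IsCausal (N : ℕ) (μ ν : Measure (Path N)) (γ : Measure (Path N × Path N)) : Prop :=
  IsCoupling μ ν γ ∧
  ∀ K : Kernel (Path N) (Path N), IsSFiniteKernel K → μ ⊗ₘ K = γ →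
    ∀ t : ℕ, 1 ≤ t → t ≤ N → ∀ B : Set (Path N), MeasurableSet[filt N t] B →
      ∃ g : Path N → ℝ≥0∞, Measurable[filt N t] g ∧ (fun x => K x B) =ᵐ[μ] g

/-- `γ` is a bicausal transport plan between `μ` and `ν`. -/
def IsBicausal (N : ℕ) (μ ν : Measure (Path N)) (γ : Measure (Path N × Path N)) : Prop :=
  IsCausal N μ ν γ ∧ IsCausal N ν μ (γ.map Prod.swap)

/-- Regular conditional distribution, under `μ`, of the coordinate of index `t`
given the first `t` coordinates. -/
def nextK (N : ℕ) (μ : Measure (Path N)) [IsFiniteMeasure μ] (t : ℕ) :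
    Kernel (Fin t → ℝ) ℝ :=
  (μ.map (fun x => (proj N t x, coord N t x))).condKernel

/-- Regular conditional distribution, under `μ`, of all the coordinates after time `t`
given the first `t` coordinates. -/
def tailK (N : ℕ) (μ : Measure (Path N)) [IsFiniteMeasure μ] (t : ℕ) :
    Kernel (Fin t → ℝ) (Fin (N - t) → ℝ) :=
  (μ.map (fun x => (proj N t x, tailProj N t x))).condKernel

/-- Regular conditional distribution, under `γ`, of the pair of coordinates of index `t`
given the first `t` coordinates of both paths. -/
def stepK (N : ℕ) (γ : Measure (Path N × Path N)) [IsFiniteMeasure γ] (t : ℕ) :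
    Kernel ((Fin t → ℝ) × (Fin t → ℝ)) (ℝ × ℝ) :=
  (γ.map (fun p => (pairProj N t p, (coord N t p.1, coord N t p.2)))).condKernel

/-- Regular conditional distribution, under `μ`, of the coordinate of index `t` given the
single coordinate of index `t-1` (one-step Markov transition kernel). -/
def mstep (N : ℕ) (μ : Measure (Path N)) [IsFiniteMeasure μ] (t : ℕ) : Kernel ℝ ℝ :=
  (μ.map (fun x => (coord N (t - 1) x, coord N t x))).condKernel

/-- `μ` is a Markov measure. -/
def IsMarkovMeasure (N : ℕ) (μ : Measure (Path N)) [IsFiniteMeasure μ] : Prop :=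
  ∀ (t : ℕ) (ht : 1 ≤ t) (_ : t < N),
    ∀ᵐ xs ∂(μ.map (proj N t)), nextK N μ t xs = mstep N μ t (xs ⟨t - 1, by omega⟩)

/-- A causal plan is causal quasi-Markov if (every version of) the conditional law of
`(x_{t+1}, y_{t+1})` given `(x_1,…,x_t,y_1,…,y_t)` depends a.s. only on `(x_t, y_1,…,y_t)`. -/
def IsQuasiMarkov (N : ℕ) (γ : Measure (Path N × Path N)) : Prop :=
  ∀ (t : ℕ) (ht : 1 ≤ t) (_ : t < N),
    ∀ S : Kernel ((Fin t → ℝ) × (Fin t → ℝ)) (ℝ × ℝ), IsSFiniteKernel S →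
      (γ.map (pairProj N t)) ⊗ₘ S
          = γ.map (fun p => (pairProj N t p, (coord N t p.1, coord N t p.2))) →
      ∃ κ : Kernel (ℝ × (Fin t → ℝ)) (ℝ × ℝ),
        ∀ᵐ z ∂(γ.map (pairProj N t)), S z = κ (z.1 ⟨t - 1, by omega⟩, z.2)

/-- Topological support of a measure. -/
def msupport {α : Type*} [TopologicalSpace α] [MeasurableSpace α] (μ : Measure α) : Set α :=
  {x | ∀ U : Set α, IsOpen U → x ∈ U → μ U ≠ 0}

/-- `K` is a version of the disintegration of `μ` at time `t` which is weakly continuous on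
the support of the first `t` coordinates of `μ`. -/
def WeaklyContinuousDisintegration (N t : ℕ) (μ : Measure (Path N))
    (K : Kernel (Fin t → ℝ) (Fin (N - t) → ℝ)) : Prop :=
  IsMarkovKernel K ∧
  (μ.map (proj N t)) ⊗ₘ K = μ.map (fun x => (proj N t x, tailProj N t x)) ∧
  ∀ f : (Fin (N - t) → ℝ) →ᵇ ℝ,
    ContinuousOn (fun xs => ∫ z, f z ∂(K xs)) (msupport (μ.map (proj N t)))

/-- `μ` is successively weakly continuous. -/
def SuccWeakCont (N : ℕ) (μ : Measure (Path N)) : Prop :=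
  ∀ t : ℕ, t < N → ∃ K : Kernel (Fin t → ℝ) (Fin (N - t) → ℝ),
    WeaklyContinuousDisintegration N t μ K

/-- The cumulative distribution function of a measure on `ℝ`. -/
def cdf1 (η : Measure ℝ) (z : ℝ) : ℝ := (η (Iic z)).toReal

/-- The left-continuous generalized inverse (quantile function) of the c.d.f. of `η`. -/
def qinv (η : Measure ℝ) (u : ℝ) : ℝ := sInf {y : ℝ | u ≤ cdf1 η y}

/-- Partial Knothe–Rosenblatt path built from the "uniform" inputs `u`. -/
def krPartial (N : ℕ) (μ : Measure (Path N)) [IsFiniteMeasure μ] (u : ℕ → ℝ) :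
    (t : ℕ) → Fin t → ℝ
  | 0 => Fin.elim0
  | t + 1 => snocFun t (krPartial N μ u t)
      (qinv (nextK N μ t (krPartial N μ u t)) (u t))

/-- The Knothe–Rosenblatt (quantile transform) path built from uniform inputs. -/
def krPath (N : ℕ) (μ : Measure (Path N)) [IsFiniteMeasure μ] (u : Path N) : Path N :=
  krPartial N μ (fun n => if h : n < N then u ⟨n, h⟩ else 0) N

/-- The uniform distribution on `[0,1]`. -/
def unif01 : Measure ℝ := volume.restrict (Icc (0 : ℝ) 1)

instance : IsProbabilityMeasure unif01 := by
  constructor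
  simp [unif01, Real.volume_Icc]

/-- N independent uniforms on `[0,1]`. -/
def uniformCube (N : ℕ) : Measure (Path N) := Measure.pi fun _ => unif01

instance (N : ℕ) : IsProbabilityMeasure (uniformCube N) :=
  inferInstanceAs (IsProbabilityMeasure (Measure.pi fun _ : Fin N => unif01))

/-- The (increasing) Knothe–Rosenblatt rearrangement of `(μ, ν)`: the joint law of
`(X*, Y*)` where both paths are built from the same independent uniforms. -/
def krCoupling (N : ℕ) (μ ν : Measure (Path N)) [IsFiniteMeasure μ] [IsFiniteMeasure ν] :
    Measure (Path N × Path N) :=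
  (uniformCube N).map (fun u => (krPath N μ u, krPath N ν u))

/-- Partial Knothe–Rosenblatt Monge map. -/
def krMapPartial (N : ℕ) (μ ν : Measure (Path N)) [IsFiniteMeasure μ] [IsFiniteMeasure ν]
    (x : Path N) : (t : ℕ) → Fin t → ℝ
  | 0 => Fin.elim0
  | t + 1 => snocFun t (krMapPartial N μ ν x t)
      (qinv (nextK N ν t (krMapPartial N μ ν x t))
        (cdf1 (nextK N μ t (proj N t x)) (coord N t x)))

/-- The Knothe–Rosenblatt Monge map from `μ` to `ν`. -/
def krMap (N : ℕ) (μ ν : Measure (Path N)) [IsFiniteMeasure μ] [IsFiniteMeasure ν]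
    (x : Path N) : Path N :=
  krMapPartial N μ ν x N

open Classical in
/-- Relative entropy `Ent(ν|μ)`, via the nonnegative integrand `f log f - f + 1`,
`f = dν/dμ`; equals `∫ log (dν/dμ) dν` for probability measures. -/
def relEnt {α : Type*} [MeasurableSpace α] (ν μ : Measure α) : ℝ≥0∞ :=
  if ν ≪ μ then
    ∫⁻ x, ENNReal.ofReal
      ((ν.rnDeriv μ x).toReal * Real.log (ν.rnDeriv μ x).toReal
        - (ν.rnDeriv μ x).toReal + 1) ∂μ
  else ∞

/-- Universally measurable `ℝ≥0∞`-valued function. -/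
def UnivMeasurable {α : Type*} [MeasurableSpace α] (f : α → ℝ≥0∞) : Prop :=
  ∀ P : Measure α, IsFiniteMeasure P → AEMeasurable f P

/-! ### Quantile functions -/

lemma cdf1_eq_cdf (η : Measure ℝ) [IsProbabilityMeasure η] (y : ℝ) : cdf1 η y = cdf η y := by
  rw [cdf_eq_real]; rfl

lemma qinv_le_iff (η : Measure ℝ) [IsProbabilityMeasure η] {u : ℝ} (hu : 0 < u)
    (hne : ∃ z, u ≤ cdf1 η z) (y : ℝ) : qinv η u ≤ y ↔ u ≤ cdf1 η y := by
  have hmono : Monotone (cdf1 η) := by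
    intro a b hab; rw [cdf1_eq_cdf, cdf1_eq_cdf]; exact monotone_cdf η hab
  have hbdd : BddBelow {y : ℝ | u ≤ cdf1 η y} := by
    have h := (tendsto_cdf_atBot η).eventually (gt_mem_nhds hu)
    obtain ⟨a, ha⟩ := h.exists
    refine ⟨a, fun y hy => ?_⟩
    by_contra hlt
    have := hmono (not_le.1 hlt).le
    rw [mem_ofPred_eq] at hy
    rw [cdf1_eq_cdf η a] at this
    linarith
  constructor
  · intro h
    have hz : ∀ z, y < z → u ≤ cdf η z := by
      intro z hz
      obtain ⟨w, hw, hwz⟩ := exists_lt_of_csInf_lt hne (lt_of_le_of_lt h hz)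
      rw [← cdf1_eq_cdf]
      exact le_trans hw (hmono hwz.le)
    rw [cdf1_eq_cdf]
    have hr : ContinuousWithinAt (cdf η) (Ioi y) y :=
      ((cdf η).right_continuous y).mono Ioi_subset_Ici_self
    exact ge_of_tendsto hr (eventually_nhdsWithin_of_forall hz)
  · intro h
    exact csInf_le hbdd h

lemma exists_cdf1_ge (η : Measure ℝ) [IsProbabilityMeasure η] {u : ℝ} (hu : u < 1) :
    ∃ z, u ≤ cdf1 η z := by
  obtain ⟨a, ha⟩ := ((tendsto_cdf_atTop η).eventually (lt_mem_nhds hu)).exists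
  exact ⟨a, by rw [cdf1_eq_cdf]; exact ha.le⟩

lemma qinv_le_iff' (η : Measure ℝ) [IsProbabilityMeasure η] {u : ℝ} (hu : u ∈ Ioo (0 : ℝ) 1)
    (y : ℝ) : qinv η u ≤ y ↔ u ≤ cdf1 η y :=
  qinv_le_iff η hu.1 (exists_cdf1_ge η hu.2) y

lemma qinv_bad (η : Measure ℝ) [IsProbabilityMeasure η] {u : ℝ}
    (h : ¬ (0 < u ∧ ∃ n : ℕ, u ≤ cdf1 η n)) : qinv η u = 0 := by
  unfold qinv
  by_cases hu : 0 < u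
  · have : {y : ℝ | u ≤ cdf1 η y} = ∅ := by
      ext y
      simp only [mem_ofPred_eq, mem_empty_iff_false, iff_false]
      intro hy
      obtain ⟨n, hn⟩ := exists_nat_ge y
      refine h ⟨hu, n, hy.trans ?_⟩
      rw [cdf1_eq_cdf, cdf1_eq_cdf]; exact monotone_cdf η hn
    rw [this, Real.sInf_empty]
  · have : {y : ℝ | u ≤ cdf1 η y} = univ := by
      ext y
      simp only [mem_ofPred_eq, mem_univ, iff_true]
      exact (not_lt.1 hu).trans ENNReal.toReal_nonneg
    rw [this, Real.sInf_univ]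

lemma qinv_monotoneOn (η : Measure ℝ) [IsProbabilityMeasure η] :
    MonotoneOn (qinv η) (Ioo 0 1) := by
  intro a ha b hb hab
  rw [qinv_le_iff' η ha]
  exact hab.trans ((qinv_le_iff' η hb _).1 le_rfl)

lemma measurable_cdf1_kernel {α : Type*} [MeasurableSpace α] (κ : Kernel α ℝ) [IsMarkovKernel κ] :
    Measurable (fun p : α × ℝ => cdf1 (κ p.1) p.2) := by
  unfold cdf1
  refine Measurable.ennreal_toReal ?_
  have hs : MeasurableSet {q : (α × ℝ) × ℝ | q.2 ≤ q.1.2} :=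
    measurableSet_le measurable_snd (measurable_snd.comp measurable_fst)
  exact Kernel.measurable_kernel_prodMk_left (κ := κ.comap Prod.fst measurable_fst) hs

lemma measurable_qinv_kernel {α : Type*} [MeasurableSpace α] (κ : Kernel α ℝ) [IsMarkovKernel κ] :
    Measurable (fun p : α × ℝ => qinv (κ p.1) p.2) := by
  have hc : ∀ y : ℝ, MeasurableSet {p : α × ℝ | p.2 ≤ cdf1 (κ p.1) y} := by
    intro y
    refine measurableSet_le measurable_snd ?_
    exact (measurable_cdf1_kernel κ).comp (measurable_fst.prodMk measurable_const)
  have hg : MeasurableSet {p : α × ℝ | 0 < p.2 ∧ ∃ n : ℕ, p.2 ≤ cdf1 (κ p.1) n} := by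
    rw [Set.ofPred_and]
    refine (measurableSet_lt measurable_const measurable_snd).inter ?_
    have : {p : α × ℝ | ∃ n : ℕ, p.2 ≤ cdf1 (κ p.1) n}
        = ⋃ n : ℕ, {p : α × ℝ | p.2 ≤ cdf1 (κ p.1) n} := by ext; simp
    rw [this]
    exact MeasurableSet.iUnion fun n => hc n
  refine measurable_of_Iic fun y => ?_
  have : (fun p : α × ℝ => qinv (κ p.1) p.2) ⁻¹' Iic y
      = ({p : α × ℝ | 0 < p.2 ∧ ∃ n : ℕ, p.2 ≤ cdf1 (κ p.1) n}
          ∩ {p : α × ℝ | p.2 ≤ cdf1 (κ p.1) y})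
        ∪ ({p : α × ℝ | 0 < p.2 ∧ ∃ n : ℕ, p.2 ≤ cdf1 (κ p.1) n}ᶜ ∩ {_p | (0 : ℝ) ≤ y}) := by
    ext p
    by_cases hp : 0 < p.2 ∧ ∃ n : ℕ, p.2 ≤ cdf1 (κ p.1) n
    · have := qinv_le_iff (κ p.1) hp.1 ⟨_, hp.2.choose_spec⟩ y
      simp only [mem_preimage, mem_Iic, this, mem_union, mem_inter_iff, mem_ofPred_eq, hp,
        mem_compl_iff, not_true, false_and, or_false, true_and]
    · have := qinv_bad (κ p.1) hp
      simp only [mem_preimage, mem_Iic, this, mem_union, mem_inter_iff, mem_ofPred_eq, hp,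
        mem_compl_iff, not_false_iff, false_and, false_or, true_and]
  rw [this]
  exact (hg.inter (hc y)).union (hg.compl.inter (MeasurableSet.const _))

lemma measurable_qinv (η : Measure ℝ) [IsProbabilityMeasure η] : Measurable (qinv η) :=
  (measurable_qinv_kernel (Kernel.const Unit η)).comp
    (measurable_const (a := ()) |>.prodMk measurable_id)

lemma unif01_eq : unif01 = volume.restrict (Ioo (0 : ℝ) 1) := by
  unfold unif01
  exact (Measure.restrict_congr_set Ioo_ae_eq_Icc).symm

lemma unif01_ae : ∀ᵐ u ∂unif01, u ∈ Ioo (0 : ℝ) 1 := by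
  rw [unif01_eq]; exact ae_restrict_mem measurableSet_Ioo

lemma map_qinv (η : Measure ℝ) [IsProbabilityMeasure η] : unif01.map (qinv η) = η := by
  have : IsProbabilityMeasure (unif01.map (qinv η)) :=
    Measure.isProbabilityMeasure_map (measurable_qinv η).aemeasurable
  refine Measure.ext_of_Iic _ _ fun y => ?_
  rw [Measure.map_apply (measurable_qinv η) measurableSet_Iic]
  have h1 : unif01 (qinv η ⁻¹' Iic y) = unif01 (Iic (cdf1 η y)) := by
    apply measure_congr
    filter_upwards [unif01_ae] with u hu
    exact propext (qinv_le_iff' η hu y)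
  have h0 : 0 ≤ cdf1 η y := ENNReal.toReal_nonneg
  have h2 : cdf1 η y ≤ 1 := by rw [cdf1_eq_cdf]; exact cdf_le_one η y
  rw [h1, unif01, Measure.restrict_apply measurableSet_Iic]
  have : Iic (cdf1 η y) ∩ Icc 0 1 = Icc 0 (cdf1 η y) := by
    ext z; simp only [mem_inter_iff, mem_Iic, mem_Icc]; constructor
    · rintro ⟨a, b, c⟩; exact ⟨b, a⟩
    · rintro ⟨a, b⟩; exact ⟨b, a, b.trans h2⟩
  rw [this, Real.volume_Icc, sub_zero, cdf1, ENNReal.ofReal_toReal (measure_ne_top _ _)]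

lemma cdf1_qinv (η : Measure ℝ) [IsProbabilityMeasure η] (hη : ∀ r, η {r} = 0) {u : ℝ}
    (hu : u ∈ Ioo (0 : ℝ) 1) : cdf1 η (qinv η u) = u := by
  apply le_antisymm
  · have h1 : η (Iic (qinv η u)) = η (Iio (qinv η u)) := by
      have : Iic (qinv η u) = Iio (qinv η u) ∪ {qinv η u} := by
        ext z; simp [le_iff_lt_or_eq]
      apply le_antisymm
      · rw [this]; refine (measure_union_le _ _).trans ?_; rw [hη, add_zero]
      · exact measure_mono Iio_subset_Iic_self
    have h2 : η (Iio (qinv η u)) ≤ ENNReal.ofReal u := by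
      have : Iio (qinv η u) = ⋃ n : ℕ, Iic (qinv η u - 1 / ((n : ℝ) + 1)) := by
        ext z
        simp only [mem_Iio, mem_iUnion, mem_Iic]
        constructor
        · intro hz
          obtain ⟨n, hn⟩ := exists_nat_one_div_lt (sub_pos.2 hz)
          exact ⟨n, by linarith⟩
        · rintro ⟨n, hn⟩
          have : (0 : ℝ) < 1 / ((n : ℝ) + 1) := by positivity
          linarith
      rw [this, Monotone.measure_iUnion]
      · refine iSup_le fun n => ?_
        have hpos : (0 : ℝ) < 1 / ((n : ℝ) + 1) := by positivity
        have : ¬ (u ≤ cdf1 η (qinv η u - 1 / ((n : ℝ) + 1))) := by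
          rw [← qinv_le_iff' η hu]; linarith
        have h3 : η (Iic (qinv η u - 1 / ((n : ℝ) + 1)))
            = ENNReal.ofReal (cdf1 η (qinv η u - 1 / ((n : ℝ) + 1))) := by
          rw [cdf1, ENNReal.ofReal_toReal (measure_ne_top _ _)]
        rw [h3]
        exact ENNReal.ofReal_le_ofReal (not_le.1 this).le
      · intro a b hab
        apply Iic_subset_Iic.2
        have := one_div_le_one_div_of_le (a := (a : ℝ) + 1) (b := (b : ℝ) + 1) (by positivity)
          (by have : (a : ℝ) ≤ b := by exact_mod_cast hab
              linarith)
        linarith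
    rw [cdf1, h1]
    exact ENNReal.toReal_le_of_le_ofReal hu.1.le h2
  · exact (qinv_le_iff' η hu _).1 le_rfl

/-! ### One-dimensional transport -/

lemma upper_diff (κ : Measure (ℝ × ℝ)) [IsProbabilityMeasure κ] (f g : ℝ → ℝ)
    (hf : Measurable f) (hg : Measurable g)
    (hfm : MonotoneOn f (Ioo 0 1)) (hgm : MonotoneOn g (Ioo 0 1))
    (h1 : κ.map Prod.fst = unif01.map f) (h2 : κ.map Prod.snd = unif01.map g)
    (S T : Set ℝ) (hS : IsUpperSet S) (hT : IsUpperSet T)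
    (hSm : MeasurableSet S) (hTm : MeasurableSet T) :
    unif01 {v | f v ∈ S ∧ g v ∉ T} ≤ κ {p | p.1 ∈ S ∧ p.2 ∉ T} := by
  by_cases hsub : ∀ v ∈ Ioo (0 : ℝ) 1, f v ∈ S → g v ∈ T
  · have : unif01 {v | f v ∈ S ∧ g v ∉ T} = 0 := by
      rw [measure_eq_zero_iff_ae_notMem]
      filter_upwards [unif01_ae] with v hv hh
      exact hh.2 (hsub v hv hh.1)
    rw [this]; exact zero_le
  · push Not at hsub
    obtain ⟨v0, hv0, hfS, hgT⟩ := hsub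
    have hsub2 : ∀ v ∈ Ioo (0 : ℝ) 1, g v ∈ T → f v ∈ S := by
      intro v hv hgv
      have : v0 ≤ v := by
        by_contra hlt
        exact hgT (hT (hgm hv hv0 (not_le.1 hlt).le) hgv)
      exact hS (hfm hv0 hv this) hfS
    have e1 : unif01 (f ⁻¹' S) = κ (Prod.fst ⁻¹' S) := by
      rw [← Measure.map_apply hf hSm, ← h1, Measure.map_apply measurable_fst hSm]
    have e2 : unif01 (g ⁻¹' T) = κ (Prod.snd ⁻¹' T) := by
      rw [← Measure.map_apply hg hTm, ← h2, Measure.map_apply measurable_snd hTm]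
    have e3 : unif01 (f ⁻¹' S) = unif01 {v | f v ∈ S ∧ g v ∉ T} + unif01 (g ⁻¹' T) := by
      rw [← measure_union]
      · apply measure_congr
        filter_upwards [unif01_ae] with v hv
        refine propext ?_
        have := hsub2 v hv
        change f v ∈ S ↔ (f v ∈ S ∧ g v ∉ T) ∨ g v ∈ T
        tauto
      · rw [Set.disjoint_left]; intro v hv hv'; exact hv.2 hv'
      · exact hg hTm
    have e4 : κ (Prod.fst ⁻¹' S) ≤ κ {p | p.1 ∈ S ∧ p.2 ∉ T} + κ (Prod.snd ⁻¹' T) := by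
      refine (measure_mono ?_).trans (measure_union_le _ _)
      intro p hp
      by_cases h : p.2 ∈ T
      · exact Or.inr h
      · exact Or.inl ⟨hp, h⟩
    rw [← e1, ← e2, e3] at e4
    exact (ENNReal.add_le_add_iff_right (measure_ne_top _ _)).1 e4

lemma layer_ineq (κ : Measure (ℝ × ℝ)) [IsProbabilityMeasure κ] (f g : ℝ → ℝ)
    (hf : Measurable f) (hg : Measurable g)
    (hfm : MonotoneOn f (Ioo 0 1)) (hgm : MonotoneOn g (Ioo 0 1))
    (h1 : κ.map Prod.fst = unif01.map f) (h2 : κ.map Prod.snd = unif01.map g)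
    (D : ℝ → ℝ) (hD : Monotone D) (hD0 : ∀ r, 0 ≤ D r) (w : ℝ) :
    ∫⁻ v, ENNReal.ofReal (if g v < w then D (f v - w) else 0) ∂unif01
      ≤ ∫⁻ p, ENNReal.ofReal (if p.2 < w then D (p.1 - w) else 0) ∂κ := by
  have hDm := hD.measurable
  rw [lintegral_eq_lintegral_meas_lt, lintegral_eq_lintegral_meas_lt]
  · refine setLIntegral_mono' measurableSet_Ioi fun t ht => ?_
    have ht : 0 < t := ht
    have := upper_diff κ f g hf hg hfm hgm h1 h2 {x | t < D (x - w)} (Ici w)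
      (fun a b hab ha => lt_of_lt_of_le ha (hD (by linarith))) (isUpperSet_Ici w)
      (measurableSet_lt measurable_const (hDm.comp (measurable_id.sub_const w)))
      measurableSet_Ici
    convert this using 2
    · ext v
      simp only [mem_ofPred_eq, mem_Ici, not_le]
      split_ifs with h
      · simp [h]
      · simp [h, ht.le]
    · ext v
      simp only [mem_ofPred_eq, mem_Ici, not_le]
      split_ifs with h
      · simp [h]
      · simp [h, ht.le]
  · refine ae_of_all _ fun p => ?_
    dsimp only [Pi.zero_apply]
    split_ifs
    · exact hD0 _
    · exact le_rfl
  · refine Measurable.aemeasurable ?_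
    exact Measurable.ite (measurableSet_lt measurable_snd measurable_const)
      (hDm.comp (measurable_fst.sub_const w)) measurable_const
  · refine ae_of_all _ fun p => ?_
    dsimp only [Pi.zero_apply]
    split_ifs
    · exact hD0 _
    · exact le_rfl
  · refine Measurable.aemeasurable ?_
    exact Measurable.ite (measurableSet_lt hg measurable_const)
      (hDm.comp (hf.sub_const w)) measurable_const

lemma convex_repr (φ : ℝ → ℝ) (hc : ConvexOn ℝ univ φ) (hm : Monotone φ) (h0 : ∀ z, 0 ≤ φ z) :
    ∃ (C : ℝ≥0∞) (D : ℝ → ℝ), Monotone D ∧ (∀ r, 0 ≤ D r) ∧ ∀ x y : ℝ,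
      ENNReal.ofReal (φ (x - y))
        = C + ∫⁻ w, ENNReal.ofReal (if y < w then D (x - w) else 0) := by
  set D : ℝ → ℝ := fun r => derivWithin φ (Ioi r) r with hDdef
  have hDmono : Monotone D := by
    have := hc.monotoneOn_rightDeriv
    rw [interior_univ] at this
    exact monotoneOn_univ.1 this
  have hder : ∀ r, HasDerivWithinAt φ (D r) (Ioi r) r := fun r =>
    hc.hasDerivWithinAt_rightDeriv_of_mem_interior (by simp)
  have hD0 : ∀ r, 0 ≤ D r := fun r => (hm.monotoneOn _).derivWithin_nonneg
  have hcont : Continuous φ := by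
    have := hc.continuousOn isOpen_univ
    exact continuousOn_univ.1 this
  have hint : ∀ a b : ℝ, a ≤ b → ∫⁻ r in Ioo a b, ENNReal.ofReal (D r)
      = ENNReal.ofReal (φ b - φ a) := by
    intro a b hab
    have hi : IntervalIntegrable D volume a b := (hDmono.monotoneOn _).intervalIntegrable
    rw [← intervalIntegral.integral_eq_sub_of_hasDeriv_right hcont.continuousOn
      (fun x _ => hder x) hi, intervalIntegral.integral_of_le hab,
      ofReal_integral_eq_lintegral_ofReal]
    · exact setLIntegral_congr Ioo_ae_eq_Ioc
    · exact (intervalIntegrable_iff_integrableOn_Ioc_of_le hab).1 hi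
    · exact ae_of_all _ fun r => hD0 r
  have hbdd : BddBelow (range φ) := ⟨0, by rintro _ ⟨z, rfl⟩; exact h0 z⟩
  have hL0 : 0 ≤ ⨅ z, φ z := le_ciInf h0
  have hIio : ∀ z : ℝ, ∫⁻ r in Iio z, ENNReal.ofReal (D r)
      = ENNReal.ofReal (φ z - ⨅ z, φ z) := by
    intro z
    have hU : Iio z = ⋃ n : ℕ, Ioo (z - n) z := by
      ext r
      simp only [mem_Iio, mem_iUnion, mem_Ioo]
      constructor
      · intro hr
        obtain ⟨n, hn⟩ := exists_nat_gt (z - r)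
        exact ⟨n, by linarith, hr⟩
      · rintro ⟨n, -, h⟩; exact h
    have hmon : Monotone fun n : ℕ => Ioo (z - n) z := by
      intro a b hab
      apply Ioo_subset_Ioo_left
      have : (a : ℝ) ≤ b := by exact_mod_cast hab
      linarith
    rw [hU, setLIntegral_iUnion_of_directed _ hmon.directed_le]
    have hn : ∀ n : ℕ, ∫⁻ r in Ioo (z - n) z, ENNReal.ofReal (D r)
        = ENNReal.ofReal (φ z - φ (z - n)) := fun n =>
      hint _ _ (by have : (0 : ℝ) ≤ n := Nat.cast_nonneg n
                   linarith)
    simp_rw [hn]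
    refine iSup_eq_of_tendsto ?_ ?_
    · intro a b hab
      apply ENNReal.ofReal_le_ofReal
      have : φ (z - b) ≤ φ (z - a) := hm (by
        have : (a : ℝ) ≤ b := by exact_mod_cast hab
        linarith)
      linarith
    · refine ENNReal.tendsto_ofReal (Tendsto.sub tendsto_const_nhds ?_)
      refine (tendsto_atBot_ciInf hm hbdd).comp ?_
      exact tendsto_const_nhds.add_atBot (tendsto_neg_atTop_atBot.comp tendsto_natCast_atTop_atTop)
  refine ⟨ENNReal.ofReal (⨅ z, φ z), D, hDmono, hD0, fun x y => ?_⟩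
  have hsub : ∫⁻ w, ENNReal.ofReal (if y < w then D (x - w) else 0)
      = ∫⁻ r in Iio (x - y), ENNReal.ofReal (D r) := by
    rw [← lintegral_indicator measurableSet_Iio,
      ← lintegral_sub_left_eq_self
        ((Iio (x - y)).indicator fun r => ENNReal.ofReal (D r)) x]
    refine lintegral_congr fun w => ?_
    rw [Set.indicator_apply]
    have : (x - w ∈ Iio (x - y)) ↔ y < w := by simp
    by_cases h : y < w
    · rw [if_pos h, if_pos (this.2 h)]
    · rw [if_neg h, if_neg (fun h' => h (this.1 h')), ENNReal.ofReal_zero]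
  rw [hsub, hIio, ← ENNReal.ofReal_add hL0 (sub_nonneg.2 (ciInf_le hbdd _))]
  congr 1; ring

/-- Optimality of a comonotone coupling for a nondecreasing convex cost. -/
lemma comono_mono (κ : Measure (ℝ × ℝ)) [IsProbabilityMeasure κ] (f g : ℝ → ℝ)
    (hf : Measurable f) (hg : Measurable g)
    (hfm : MonotoneOn f (Ioo 0 1)) (hgm : MonotoneOn g (Ioo 0 1))
    (h1 : κ.map Prod.fst = unif01.map f) (h2 : κ.map Prod.snd = unif01.map g)
    (φ : ℝ → ℝ) (hc : ConvexOn ℝ univ φ) (hm : Monotone φ) (h0 : ∀ z, 0 ≤ φ z) :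
    ∫⁻ v, ENNReal.ofReal (φ (f v - g v)) ∂unif01
      ≤ ∫⁻ p, ENNReal.ofReal (φ (p.1 - p.2)) ∂κ := by
  obtain ⟨C, D, hD, hD0, hr⟩ := convex_repr φ hc hm h0
  have hDm := hD.measurable
  simp_rw [hr]
  rw [lintegral_add_left measurable_const, lintegral_add_left measurable_const]
  simp only [lintegral_const, measure_univ]
  gcongr 1
  rw [lintegral_lintegral_swap (μ := unif01), lintegral_lintegral_swap (μ := κ)]
  · exact lintegral_mono fun w => layer_ineq κ f g hf hg hfm hgm h1 h2 D hD hD0 w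
  · refine (ENNReal.measurable_ofReal.comp ?_).aemeasurable
    exact Measurable.ite (measurableSet_lt (measurable_snd.comp measurable_fst) measurable_snd)
      (hDm.comp ((measurable_fst.comp measurable_fst).sub measurable_snd)) measurable_const
  · refine (ENNReal.measurable_ofReal.comp ?_).aemeasurable
    exact Measurable.ite (measurableSet_lt (hg.comp measurable_fst) measurable_snd)
      (hDm.comp ((hf.comp measurable_fst).sub measurable_snd)) measurable_const

lemma convexOn_comp_neg (φ : ℝ → ℝ) (hc : ConvexOn ℝ univ φ) :
    ConvexOn ℝ univ (fun z => φ (-z)) := by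
  refine ⟨convex_univ, fun x _ y _ a b ha hb hab => ?_⟩
  have := hc.2 (mem_univ (-x)) (mem_univ (-y)) ha hb hab
  simp only [smul_eq_mul] at this ⊢
  convert this using 2
  ring

lemma comono_anti (κ : Measure (ℝ × ℝ)) [IsProbabilityMeasure κ] (f g : ℝ → ℝ)
    (hf : Measurable f) (hg : Measurable g)
    (hfm : MonotoneOn f (Ioo 0 1)) (hgm : MonotoneOn g (Ioo 0 1))
    (h1 : κ.map Prod.fst = unif01.map f) (h2 : κ.map Prod.snd = unif01.map g)
    (φ : ℝ → ℝ) (hc : ConvexOn ℝ univ φ) (hm : Antitone φ) (h0 : ∀ z, 0 ≤ φ z) :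
    ∫⁻ v, ENNReal.ofReal (φ (f v - g v)) ∂unif01
      ≤ ∫⁻ p, ENNReal.ofReal (φ (p.1 - p.2)) ∂κ := by
  have : IsProbabilityMeasure (κ.map Prod.swap) :=
    Measure.isProbabilityMeasure_map measurable_swap.aemeasurable
  have hφm : Measurable φ := hm.measurable
  have := comono_mono (κ.map Prod.swap) g f hg hf hgm hfm
    (by rw [Measure.map_map measurable_fst measurable_swap]; exact h2)
    (by rw [Measure.map_map measurable_snd measurable_swap]; exact h1)
    (fun z => φ (-z)) (convexOn_comp_neg φ hc) (fun a b hab => hm (neg_le_neg hab))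
    (fun z => h0 _)
  rw [lintegral_map (by fun_prop) measurable_swap] at this
  simpa using this

lemma convexOn_max (φ : ℝ → ℝ) (hc : ConvexOn ℝ univ φ) (z0 : ℝ) (hmin : ∀ z, φ z0 ≤ φ z) :
    MonotoneOn φ (Ici z0) ∧ AntitoneOn φ (Iic z0) := by
  constructor
  · intro a ha b hb hab
    rcases eq_or_lt_of_le hab with rfl | hlt
    · exact le_rfl
    have ha : z0 ≤ a := ha
    have := hc.le_max_of_mem_Icc (mem_univ z0) (mem_univ b) (z := a) ⟨ha, hab⟩
    exact this.trans (max_le (hmin b) le_rfl)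
  · intro a ha b hb hab
    have hb : b ≤ z0 := hb
    have := hc.le_max_of_mem_Icc (mem_univ a) (mem_univ z0) (z := b) ⟨hab, hb⟩
    exact this.trans (max_le le_rfl (hmin a))

lemma convexOn_comp_max (φ : ℝ → ℝ) (hc : ConvexOn ℝ univ φ) (z0 : ℝ)
    (hmin : ∀ z, φ z0 ≤ φ z) : ConvexOn ℝ univ (fun z => φ (max z z0)) := by
  have hmono := (convexOn_max φ hc z0 hmin).1
  refine ⟨convex_univ, fun x _ y _ a b ha hb hab => ?_⟩
  have := hc.2 (mem_univ (max x z0)) (mem_univ (max y z0)) ha hb hab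
  have key : z0 ≤ a * max x z0 + b * max y z0 := by
    have e1 := mul_le_mul_of_nonneg_left (le_max_right x z0) ha
    have e2 := mul_le_mul_of_nonneg_left (le_max_right y z0) hb
    have e3 : z0 = a * z0 + b * z0 := by rw [← add_mul, hab, one_mul]
    linarith
  refine le_trans (hmono (mem_Ici.2 ?_) (mem_Ici.2 ?_) ?_) this
  · exact le_max_right _ _
  · exact key
  · simp only [smul_eq_mul]
    refine max_le ?_ ?_
    · nlinarith [le_max_left x z0, le_max_left y z0]
    · exact key

lemma exists_min_or (φ : ℝ → ℝ) (hc : ConvexOn ℝ univ φ) :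
    Monotone φ ∨ Antitone φ ∨ ∃ z0, ∀ z, φ z0 ≤ φ z := by
  have hcont : Continuous φ := continuousOn_univ.1 (hc.continuousOn isOpen_univ)
  by_cases h1 : Monotone φ
  · exact Or.inl h1
  by_cases h2 : Antitone φ
  · exact Or.inr (Or.inl h2)
  refine Or.inr (Or.inr ?_)
  unfold Monotone at h1
  unfold Antitone at h2
  push Not at h1 h2
  obtain ⟨a, b, hab, hlt⟩ := h1
  obtain ⟨c, d, hcd, hlt2⟩ := h2
  -- φ b < φ a with a ≤ b, φ c < φ d with c ≤ d
  have hab : a < b := lt_of_le_of_ne hab (by rintro rfl; exact lt_irrefl _ hlt)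
  have hcd : c < d := lt_of_le_of_ne hcd (by rintro rfl; exact lt_irrefl _ hlt2)
  have hleft : ∀ z, z ≤ a → φ b ≤ φ z := by
    intro z hz
    by_contra hcon
    have := hc.le_max_of_mem_Icc (mem_univ z) (mem_univ b) (z := a) ⟨hz, hab.le⟩
    rcases le_max_iff.1 this with h | h <;> linarith
  have hright : ∀ z, d ≤ z → φ c ≤ φ z := by
    intro z hz
    by_contra hcon
    have := hc.le_max_of_mem_Icc (mem_univ c) (mem_univ z) (z := d) ⟨hcd.le, hz⟩
    rcases le_max_iff.1 this with h | h <;> linarith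
  obtain ⟨z0, hz0, hmin⟩ := isCompact_Icc.exists_isMinOn
    (s := Icc (min (min a b) (min c d)) (max (max a b) (max c d)))
    ⟨a, by simp, by simp⟩ hcont.continuousOn
  refine ⟨z0, fun z => ?_⟩
  have hb := hmin (a := b) ⟨by simp, by simp⟩
  have hcc := hmin (a := c) ⟨by simp, by simp⟩
  simp only [mem_ofPred_eq] at hb hcc
  by_cases hz1 : z ≤ a
  · exact hb.trans (hleft z hz1)
  by_cases hz2 : d ≤ z
  · exact hcc.trans (hright z hz2)
  · push Not at hz1 hz2
    exact hmin ⟨(((min_le_left _ _).trans (min_le_left _ _)).trans hz1.le),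
      hz2.le.trans ((le_max_right _ _).trans (le_max_right _ _))⟩

/-- Optimality of a comonotone coupling for a convex cost. -/
lemma comono_convex (κ : Measure (ℝ × ℝ)) [IsProbabilityMeasure κ] (f g : ℝ → ℝ)
    (hf : Measurable f) (hg : Measurable g)
    (hfm : MonotoneOn f (Ioo 0 1)) (hgm : MonotoneOn g (Ioo 0 1))
    (h1 : κ.map Prod.fst = unif01.map f) (h2 : κ.map Prod.snd = unif01.map g)
    (h : ℝ → ℝ) (hc : ConvexOn ℝ univ h) :
    ∫⁻ v, ENNReal.ofReal (h (f v - g v)) ∂unif01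
      ≤ ∫⁻ p, ENNReal.ofReal (h (p.1 - p.2)) ∂κ := by
  set φ : ℝ → ℝ := fun z => max (h z) 0 with hφ
  have hφc : ConvexOn ℝ univ φ := hc.sup (convexOn_const 0 convex_univ)
  have h0 : ∀ z, 0 ≤ φ z := fun z => le_max_right _ _
  have heq : ∀ z, ENNReal.ofReal (h z) = ENNReal.ofReal (φ z) := by
    intro z
    rcases le_total (h z) 0 with hz | hz
    · simp [hφ, hz, ENNReal.ofReal_of_nonpos hz]
    · simp [hφ, hz]
  simp_rw [heq]
  rcases exists_min_or φ hφc with hm | hm | ⟨z0, hz0⟩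
  · exact comono_mono κ f g hf hg hfm hgm h1 h2 φ hφc hm h0
  · exact comono_anti κ f g hf hg hfm hgm h1 h2 φ hφc hm h0
  · obtain ⟨hmo, han⟩ := convexOn_max φ hφc z0 hz0
    have hcont : Continuous φ := continuousOn_univ.1 (hφc.continuousOn isOpen_univ)
    have hdec : ∀ z, ENNReal.ofReal (φ z)
        = ENNReal.ofReal (φ (max z z0)) + ENNReal.ofReal (φ (min z z0) - φ z0) := by
      intro z
      rcases le_total z z0 with hz | hz
      · rw [max_eq_right hz, min_eq_left hz, ← ENNReal.ofReal_add (h0 _) (sub_nonneg.2 (hz0 z))]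
        congr 1; ring
      · rw [max_eq_left hz, min_eq_right hz]; simp
    have hmaxc := convexOn_comp_max φ hφc z0 hz0
    have hminc : ConvexOn ℝ univ (fun z => φ (min z z0) - φ z0) := by
      have e1 := convexOn_comp_max (fun z => φ (-z)) (convexOn_comp_neg φ hφc) (-z0)
        (fun z => by simpa using hz0 (-z))
      have e2 := convexOn_comp_neg _ e1
      have e3 : (fun z => φ (min z z0)) = fun z => φ (-(max (-z) (-z0))) := by
        funext z; rw [max_neg_neg, neg_neg]
      rw [← e3] at e2
      exact e2.add_const (-φ z0)
    have i1 := comono_mono κ f g hf hg hfm hgm h1 h2 _ hmaxc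
      (fun a b hab => hmo (mem_Ici.2 (le_max_right _ _)) (mem_Ici.2 (le_max_right _ _)) (max_le_max hab le_rfl))
      (fun z => h0 _)
    have i2 := comono_anti κ f g hf hg hfm hgm h1 h2 _ hminc
      (fun a b hab => sub_le_sub_right
        (han (mem_Iic.2 (min_le_right _ _)) (mem_Iic.2 (min_le_right _ _)) (min_le_min hab le_rfl)) _)
      (fun z => sub_nonneg.2 (hz0 _))
    rw [lintegral_congr fun v => hdec (f v - g v),
      lintegral_congr fun p : ℝ × ℝ => hdec (p.1 - p.2)]
    rw [lintegral_add_left (by fun_prop), lintegral_add_left (by fun_prop)]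
    exact add_le_add i1 i2

/-! ### Projections -/

lemma measurable_proj (N t : ℕ) : Measurable (proj N t) := by
  refine measurable_pi_lambda _ fun i => ?_
  unfold proj
  by_cases h : (i : ℕ) < N
  · simp only [h, dif_pos]; exact measurable_pi_apply _
  · simp only [h, dif_neg, not_false_iff]; exact measurable_const

lemma measurable_coord (N t : ℕ) : Measurable (coord N t) := by
  unfold coord
  by_cases h : t < N
  · simp only [h, dif_pos]; exact measurable_pi_apply _
  · simp only [h, dif_neg, not_false_iff]; exact measurable_const

lemma measurable_snocFun (t : ℕ) :
    Measurable (fun q : (Fin t → ℝ) × ℝ => snocFun t q.1 q.2) := by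
  refine measurable_pi_lambda _ fun i => ?_
  unfold snocFun
  by_cases h : (i : ℕ) < t
  · simp only [h, dif_pos]; exact (measurable_pi_apply _).comp measurable_fst
  · simp only [h, dif_neg, not_false_iff]; exact measurable_snd

lemma proj_succ {N t : ℕ} (h : t < N) (x : Path N) :
    proj N (t + 1) x = snocFun t (proj N t x) (coord N t x) := by
  funext i
  by_cases hi : (i : ℕ) < t
  · simp [proj, snocFun, hi]
  · have : (i : ℕ) = t := by omega
    simp [proj, snocFun, coord, this, h]

lemma proj_self {N : ℕ} (x : Path N) : proj N N x = x := by
  funext i; simp [proj]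

lemma proj_proj {N t s : ℕ} (hts : t ≤ s) (x : Path N) :
    proj s t (proj N s x) = proj N t x := by
  funext i
  have : (i : ℕ) < s := by omega
  simp [proj, this]

lemma coord_proj {N t s : ℕ} (hts : t < s) (x : Path N) :
    coord s t (proj N s x) = coord N t x := by
  simp [proj, coord, hts]

lemma proj_snocFun {t s : ℕ} (hts : t ≤ s) (xs : Fin s → ℝ) (r : ℝ) :
    proj (s + 1) t (snocFun s xs r) = proj s t xs := by
  funext i
  have h1 : (i : ℕ) < s := by omega
  have h2 : (i : ℕ) < s + 1 := by omega
  simp [proj, snocFun, h1, h2]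

lemma coord_snocFun {s : ℕ} (xs : Fin s → ℝ) (r : ℝ) :
    coord (s + 1) s (snocFun s xs r) = r := by
  simp [coord, snocFun]

lemma coord_snocFun_lt {t s : ℕ} (h : t < s) (xs : Fin s → ℝ) (r : ℝ) :
    coord (s + 1) t (snocFun s xs r) = coord s t xs := by
  have : t < s + 1 := by omega
  simp [coord, snocFun, h, this]

lemma coord_eq {N : ℕ} (i : Fin N) (x : Path N) : coord N i x = x i := by
  simp [coord]

/-! ### Disintegration lemmas in integral form -/

lemma disint_condKernel {Ω α β : Type*} [MeasurableSpace Ω] [MeasurableSpace α]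
    [MeasurableSpace β] [StandardBorelSpace β] [Nonempty β] (ρ : Measure Ω) [IsFiniteMeasure ρ]
    (f : Ω → α) (g : Ω → β) (hf : Measurable f) (hg : Measurable g)
    (F : α × β → ℝ≥0∞) (hF : Measurable F) :
    ∫⁻ ω, F (f ω, g ω) ∂ρ
      = ∫⁻ ω, ∫⁻ b, F (f ω, b) ∂((ρ.map (fun ω => (f ω, g ω))).condKernel (f ω)) ∂ρ := by
  have h1 : ∫⁻ ω, F (f ω, g ω) ∂ρ = ∫⁻ q, F q ∂(ρ.map (fun ω => (f ω, g ω))) :=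
    (lintegral_map hF (hf.prodMk hg)).symm
  have h2 : (ρ.map (fun ω => (f ω, g ω))).fst = ρ.map f := Measure.fst_map_prodMk hg
  rw [h1]
  conv_lhs => rw [← Measure.disintegrate (ρ.map (fun ω => (f ω, g ω)))
    (ρ.map (fun ω => (f ω, g ω))).condKernel]
  rw [Measure.lintegral_compProd hF, h2, lintegral_map (Measurable.lintegral_kernel_prod_right' hF) hf]

lemma kernel_ae_unique {Ω α β : Type*} [MeasurableSpace Ω] [MeasurableSpace α]
    [MeasurableSpace β] [StandardBorelSpace β] [Nonempty β]
    (ρ : Measure Ω) [IsFiniteMeasure ρ] (f : Ω → α) (hf : Measurable f)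
    (κ₁ κ₂ : Kernel α β) [IsMarkovKernel κ₁] [IsMarkovKernel κ₂]
    (h : ∀ F : α × β → ℝ≥0∞, Measurable F →
      ∫⁻ ω, ∫⁻ b, F (f ω, b) ∂(κ₁ (f ω)) ∂ρ = ∫⁻ ω, ∫⁻ b, F (f ω, b) ∂(κ₂ (f ω)) ∂ρ) :
    ∀ᵐ ω ∂ρ, κ₁ (f ω) = κ₂ (f ω) := by
  have key : (ρ.map f) ⊗ₘ κ₁ = (ρ.map f) ⊗ₘ κ₂ := by
    refine Measure.ext_of_lintegral _ fun F hF => ?_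
    rw [Measure.lintegral_compProd hF, Measure.lintegral_compProd hF,
      lintegral_map (Measurable.lintegral_kernel_prod_right' hF) hf,
      lintegral_map (Measurable.lintegral_kernel_prod_right' hF) hf]
    exact h F hF
  exact ae_of_ae_map hf.aemeasurable (Kernel.ae_eq_of_compProd_eq key)

/-! ### Step-wise characterisation of causality -/

/-- `k` is a family of one-step disintegration kernels of `μ`. -/
def IsDisint (N : ℕ) (k : ∀ t : ℕ, Kernel (Fin t → ℝ) ℝ) (μ : Measure (Path N)) : Prop :=
  ∀ t, t < N → ∀ F : (Fin t → ℝ) × ℝ → ℝ≥0∞, Measurable F →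
    ∫⁻ x, F (proj N t x, coord N t x) ∂μ
      = ∫⁻ x, ∫⁻ r, F (proj N t x, r) ∂(k t (proj N t x)) ∂μ

/-- Under `γ`, the next first coordinate given both pasts has law `k` of the first past. -/
def IsStep (N : ℕ) (k : ∀ t : ℕ, Kernel (Fin t → ℝ) ℝ) (γ : Measure (Path N × Path N)) : Prop :=
  ∀ t, t < N → ∀ F : (Fin t → ℝ) × (Fin t → ℝ) × ℝ → ℝ≥0∞, Measurable F →
    ∫⁻ p, F (proj N t p.1, proj N t p.2, coord N t p.1) ∂γ
      = ∫⁻ p, ∫⁻ r, F (proj N t p.1, proj N t p.2, r) ∂(k t (proj N t p.1)) ∂γ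

lemma lintegral_fin0 {Ω : Type*} [MeasurableSpace Ω] (ρ : Measure Ω) [IsProbabilityMeasure ρ]
    (f : Ω → Fin 0 → ℝ) (F : (Fin 0 → ℝ) → ℝ≥0∞) : ∫⁻ ω, F (f ω) ∂ρ = F Fin.elim0 := by
  have : ∀ ω, F (f ω) = F Fin.elim0 := fun ω => congrArg F (Subsingleton.elim _ _)
  simp [this]

/-- If the law of a first-path prefix evolves by disintegration kernels of `μ`, then it is `μ`. -/
lemma trunc_law (N : ℕ) (k : ∀ t : ℕ, Kernel (Fin t → ℝ) ℝ) [∀ t, IsMarkovKernel (k t)]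
    (μ : Measure (Path N)) [IsProbabilityMeasure μ] (hμ : IsDisint N k μ)
    {Ω : Type*} [MeasurableSpace Ω] (ρ : Measure Ω) [IsProbabilityMeasure ρ]
    (X : Ω → Path N)
    (hstep : ∀ t, t < N → ∀ F : (Fin t → ℝ) × ℝ → ℝ≥0∞, Measurable F →
      ∫⁻ ω, F (proj N t (X ω), coord N t (X ω)) ∂ρ
        = ∫⁻ ω, ∫⁻ r, F (proj N t (X ω), r) ∂(k t (proj N t (X ω))) ∂ρ) :
    ∀ t, t ≤ N → ∀ F : (Fin t → ℝ) → ℝ≥0∞, Measurable F →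
      ∫⁻ ω, F (proj N t (X ω)) ∂ρ = ∫⁻ x, F (proj N t x) ∂μ := by
  intro t
  induction t with
  | zero =>
    intro _ F _
    rw [lintegral_fin0, lintegral_fin0]
  | succ t ih =>
    intro ht F hF
    have ht' : t < N := ht
    simp_rw [proj_succ ht']
    have hG : Measurable (fun q : (Fin t → ℝ) × ℝ => F (snocFun t q.1 q.2)) :=
      hF.comp (measurable_snocFun t)
    rw [hstep t ht' _ hG, hμ t ht' _ hG]
    exact ih ht'.le (fun z => ∫⁻ r, F (snocFun t z r) ∂(k t z))
      (Measurable.lintegral_kernel_prod_right' hG)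

lemma map_eq_of_trunc_law (N : ℕ) (μ : Measure (Path N))
    {Ω : Type*} [MeasurableSpace Ω] (ρ : Measure Ω)
    (X : Ω → Path N) (hX : Measurable X)
    (h : ∀ F : (Fin N → ℝ) → ℝ≥0∞, Measurable F →
      ∫⁻ ω, F (proj N N (X ω)) ∂ρ = ∫⁻ x, F (proj N N x) ∂μ) : ρ.map X = μ := by
  refine Measure.ext_of_lintegral _ fun F hF => ?_
  rw [lintegral_map hF hX]
  have := h F hF
  simpa [proj_self] using this

lemma IsStep.map_fst {N : ℕ} {k : ∀ t : ℕ, Kernel (Fin t → ℝ) ℝ} [∀ t, IsMarkovKernel (k t)]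
    {μ : Measure (Path N)} [IsProbabilityMeasure μ] (hμ : IsDisint N k μ)
    {γ : Measure (Path N × Path N)} [IsProbabilityMeasure γ] (h : IsStep N k γ) :
    γ.map Prod.fst = μ := by
  refine map_eq_of_trunc_law N μ γ Prod.fst measurable_fst ?_
  refine trunc_law N k μ hμ γ Prod.fst ?_ N le_rfl
  intro t ht F hF
  exact h t ht (fun q => F (q.1, q.2.2)) (by fun_prop)

lemma IsStep.causal_core {N : ℕ} {k : ∀ t : ℕ, Kernel (Fin t → ℝ) ℝ} [∀ t, IsMarkovKernel (k t)]
    {γ : Measure (Path N × Path N)} [IsProbabilityMeasure γ] (h : IsStep N k γ)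
    (t : ℕ) (κ : Kernel (Fin t → ℝ) (Fin t → ℝ)) [IsMarkovKernel κ]
    (hκ : ∀ F : (Fin t → ℝ) × (Fin t → ℝ) → ℝ≥0∞, Measurable F →
      ∫⁻ p, F (proj N t p.1, proj N t p.2) ∂γ
        = ∫⁻ p, ∫⁻ w, F (proj N t p.1, w) ∂(κ (proj N t p.1)) ∂γ) :
    ∀ s, t ≤ s → s ≤ N → ∀ F : (Fin s → ℝ) × (Fin t → ℝ) → ℝ≥0∞, Measurable F →
      ∫⁻ p, F (proj N s p.1, proj N t p.2) ∂γ
        = ∫⁻ p, ∫⁻ w, F (proj N s p.1, w) ∂(κ (proj N t p.1)) ∂γ := by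
  intro s hts
  induction s, hts using Nat.le_induction with
  | base => intro _ F hF; exact hκ F hF
  | succ s hts ih =>
    intro hs F hF
    have hs' : s < N := hs
    simp_rw [proj_succ hs']
    have hsn := measurable_snocFun s
    -- integrate out the next coordinate
    have hF1 : Measurable (fun q : (Fin s → ℝ) × (Fin s → ℝ) × ℝ =>
        F (snocFun s q.1 q.2.2, proj s t q.2.1)) := by
      refine hF.comp (Measurable.prodMk ?_ ?_)
      · exact hsn.comp (measurable_fst.prodMk (measurable_snd.comp measurable_snd))
      · exact (measurable_proj s t).comp (measurable_fst.comp measurable_snd)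
    have e1 := h s hs' _ hF1
    simp only [proj_proj hts] at e1
    rw [e1]
    -- use the induction hypothesis
    have hF2 : Measurable (fun q : ((Fin s → ℝ) × (Fin t → ℝ)) × ℝ =>
        F (snocFun s q.1.1 q.2, q.1.2)) := by
      refine hF.comp (Measurable.prodMk ?_ ?_)
      · exact hsn.comp ((measurable_fst.comp measurable_fst).prodMk measurable_snd)
      · exact measurable_snd.comp measurable_fst
    have e2 := ih hs'.le (fun q => ∫⁻ r, F (snocFun s q.1 r, q.2) ∂(k s q.1))
      (Measurable.lintegral_kernel_prod_right' (κ := (k s).comap Prod.fst measurable_fst) hF2)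
    simp only at e2
    rw [e2]
    -- use the step property backwards
    have hF3 : Measurable (fun q : (Fin s → ℝ) × (Fin s → ℝ) × ℝ =>
        ∫⁻ w, F (snocFun s q.1 q.2.2, w) ∂(κ (proj s t q.1))) := by
      refine Measurable.lintegral_kernel_prod_right'
        (κ := κ.comap (fun q : (Fin s → ℝ) × (Fin s → ℝ) × ℝ => proj s t q.1)
          ((measurable_proj s t).comp measurable_fst))
        (f := fun q : ((Fin s → ℝ) × (Fin s → ℝ) × ℝ) × (Fin t → ℝ) =>
          F (snocFun s q.1.1 q.1.2.2, q.2)) ?_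
      refine hF.comp (Measurable.prodMk ?_ measurable_snd)
      exact hsn.comp ((measurable_fst.comp measurable_fst).prodMk
        ((measurable_snd.comp measurable_snd).comp measurable_fst))
    have e3 := h s hs' _ hF3
    simp only [proj_proj hts] at e3
    rw [e3]
    refine lintegral_congr fun p => ?_
    refine lintegral_lintegral_swap ?_
    refine Measurable.aemeasurable ?_
    refine hF.comp (Measurable.prodMk ?_ measurable_fst)
    exact hsn.comp ((measurable_const (a := proj N s p.1)).prodMk measurable_snd)

lemma IsStep.isCausal {N : ℕ} {k : ∀ t : ℕ, Kernel (Fin t → ℝ) ℝ} [∀ t, IsMarkovKernel (k t)]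
    {μ ν : Measure (Path N)} [IsProbabilityMeasure μ]
    {γ : Measure (Path N × Path N)} [IsProbabilityMeasure γ] (h : IsStep N k γ)
    (hc : IsCoupling μ ν γ) : IsCausal N μ ν γ := by
  refine ⟨hc, fun K hK hKγ t _ htN B hB => ?_⟩
  obtain ⟨B', hB', rfl⟩ := hB
  set κ : Kernel (Fin t → ℝ) (Fin t → ℝ) :=
    (γ.map (fun p => (proj N t p.1, proj N t p.2))).condKernel with hκ
  have hp1 : Measurable (fun p : Path N × Path N => proj N t p.1) :=
    (measurable_proj N t).comp measurable_fst
  have hp2 : Measurable (fun p : Path N × Path N => proj N t p.2) :=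
    (measurable_proj N t).comp measurable_snd
  have core := h.causal_core t κ (fun F hF => disint_condKernel γ _ _ hp1 hp2 F hF) N htN le_rfl
  simp only [proj_self] at core
  refine ⟨fun x => κ (proj N t x) B', ?_, ?_⟩
  · exact (Kernel.measurable_coe κ hB').comp (comap_measurable (proj N t))
  · refine ae_eq_of_forall_setLIntegral_eq_of_sigmaFinite ?_ ?_ ?_
    · exact Kernel.measurable_coe K (measurable_proj N t hB')
    · exact (Kernel.measurable_coe κ hB').comp (measurable_proj N t)
    · intro A hA _
      have e1 := core ((A ×ˢ B').indicator 1)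
        (measurable_one.indicator (hA.prod hB'))
      have e2 : ∀ x : Path N, ∀ w, (A ×ˢ B').indicator (1 : Path N × (Fin t → ℝ) → ℝ≥0∞) (x, w)
          = A.indicator 1 x * B'.indicator 1 w := by
        intro x w
        by_cases h1 : x ∈ A <;> by_cases h2 : w ∈ B' <;> simp [h1, h2]
      have hm : Measurable (B'.indicator (1 : (Fin t → ℝ) → ℝ≥0∞)) := measurable_one.indicator hB'
      have hmA : Measurable (A.indicator (1 : Path N → ℝ≥0∞)) := measurable_one.indicator hA
      have e3 : ∫⁻ p, (A ×ˢ B').indicator 1 (p.1, proj N t p.2) ∂γ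
          = ∫⁻ x in A, K x (proj N t ⁻¹' B') ∂μ := by
        rw [← hKγ, Measure.lintegral_compProd, ← lintegral_indicator hA]
        · refine lintegral_congr fun x => ?_
          simp only [e2]
          rw [lintegral_const_mul (A.indicator 1 x)
            (f := fun w => B'.indicator 1 (proj N t w)) (hm.comp (measurable_proj N t))]
          have : ∫⁻ w, B'.indicator 1 (proj N t w) ∂(K x) = K x (proj N t ⁻¹' B') := by
            rw [← lintegral_indicator_one (measurable_proj N t hB')]
            rfl
          rw [this]
          by_cases h1 : x ∈ A <;> simp [h1]
        · exact (measurable_one.indicator (hA.prod hB')).comp (measurable_fst.prodMk hp2)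
      have e4 : ∫⁻ p, ∫⁻ w, (A ×ˢ B').indicator 1 (p.1, w) ∂(κ (proj N t p.1)) ∂γ
          = ∫⁻ x in A, κ (proj N t x) B' ∂μ := by
        simp only [e2]
        simp_rw [lintegral_const_mul _ hm, lintegral_indicator_one hB']
        rw [← hc.1, ← lintegral_indicator hA, lintegral_map _ measurable_fst]
        · refine lintegral_congr fun p => ?_
          by_cases h1 : p.1 ∈ A <;> simp [h1]
        · exact ((Kernel.measurable_coe κ hB').comp (measurable_proj N t)).indicator hA
      rw [← e3, ← e4]
      exact e1

/-! ### Independence for product measures and causal plans -/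

lemma pi_indep (N t : ℕ) (ht : t < N) (m : Fin N → Measure ℝ) [∀ i, IsProbabilityMeasure (m i)] :
    IndepFun (proj N t) (coord N t) (Measure.pi m) := by
  have h := iIndepFun_pi (μ := m) (X := fun _ => (id : ℝ → ℝ)) (fun _ => aemeasurable_id)
  have h2 := h.indepFun_finset (Finset.univ.filter fun i : Fin N => (i : ℕ) < t) {⟨t, ht⟩}
    (by simp) (fun i => (measurable_pi_apply i))
  have h3 := h2.comp
    (φ := fun z => fun i : Fin t => z ⟨⟨i, i.2.trans ht⟩, by simp⟩)
    (ψ := fun z : (({⟨t, ht⟩} : Finset (Fin N)) → ℝ) => z ⟨⟨t, ht⟩, by simp⟩)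
    (_mγ := MeasurableSpace.pi) (_mγ' := Real.measurableSpace)
    (measurable_pi_lambda _ fun i => measurable_pi_apply _)
    (measurable_pi_apply (⟨⟨t, ht⟩, by simp⟩ : ({⟨t, ht⟩} : Finset (Fin N))))
  convert h3 using 1
  · funext x i
    have : (i : ℕ) < N := i.2.trans ht
    simp [proj, this]
  · funext x
    simp [coord, ht]

lemma lintegral_indep {Ω α β : Type*} [MeasurableSpace Ω] [MeasurableSpace α]
    [MeasurableSpace β] (ρ : Measure Ω) [IsProbabilityMeasure ρ]
    (f : Ω → α) (g : Ω → β) (hf : Measurable f) (hg : Measurable g) (h : IndepFun f g ρ)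
    (F : α × β → ℝ≥0∞) (hF : Measurable F) :
    ∫⁻ ω, F (f ω, g ω) ∂ρ = ∫⁻ ω, ∫⁻ b, F (f ω, b) ∂(ρ.map g) ∂ρ := by
  have h1 := (indepFun_iff_map_prod_eq_prod_map_map hf.aemeasurable hg.aemeasurable).1 h
  have : IsProbabilityMeasure (ρ.map g) := Measure.isProbabilityMeasure_map hg.aemeasurable
  rw [← lintegral_map hF (hf.prodMk hg), h1, lintegral_prod _ hF.aemeasurable,
    lintegral_map hF.lintegral_prod_right' hf]

lemma IsCoupling.isProb {α β : Type*} [MeasurableSpace α] [MeasurableSpace β]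
    {μ : Measure α} [IsProbabilityMeasure μ] {ν : Measure β} {γ : Measure (α × β)}
    (h : IsCoupling μ ν γ) : IsProbabilityMeasure γ := by
  constructor
  have := measure_univ (μ := μ)
  rw [← h.1, Measure.map_apply measurable_fst MeasurableSet.univ] at this
  simpa using this

lemma IsCausal.indep {N : ℕ} {μ ν : Measure (Path N)} [IsProbabilityMeasure μ]
    {γ : Measure (Path N × Path N)} (h : IsCausal N μ ν γ) (t : ℕ) (ht : t < N)
    (hind : IndepFun (proj N t) (coord N t) μ) :
    IndepFun (fun p : Path N × Path N => proj N t p.2) (fun p => coord N t p.1) γ := by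
  have hγ : IsProbabilityMeasure γ := h.1.isProb
  rw [indepFun_iff_measure_inter_preimage_eq_mul]
  intro B A hB hA
  have hK : μ ⊗ₘ γ.condKernel = γ := by
    have : γ.fst = μ := h.1.1
    rw [← this]; exact γ.disintegrate γ.condKernel
  -- the conditional probability only depends on the past
  obtain ⟨g, hg, hgK⟩ : ∃ g : (Fin t → ℝ) → ℝ≥0∞, Measurable g ∧
      (fun x => γ.condKernel x (proj N t ⁻¹' B)) =ᵐ[μ] fun x => g (proj N t x) := by
    rcases Nat.eq_zero_or_pos t with rfl | hpos
    · rcases Subsingleton.eq_empty_or_singleton (subsingleton_of_subsingleton (s := B))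
        with hB0 | ⟨b, hb⟩
      · exact ⟨fun _ => 0, measurable_const, ae_of_all _ fun x => by simp [hB0]⟩
      · refine ⟨fun _ => 1, measurable_const, ae_of_all _ fun x => ?_⟩
        have : proj N 0 ⁻¹' B = univ := by
          rw [hb]; ext z; simp only [mem_preimage, mem_singleton_iff, mem_univ, iff_true]
          exact Subsingleton.elim _ _
        simp [this]
    · obtain ⟨g, hg, hgK⟩ := h.2 γ.condKernel inferInstance hK t hpos ht.le (proj N t ⁻¹' B)
        ⟨B, hB, rfl⟩
      obtain ⟨g', hg', rfl⟩ := Measurable.exists_eq_measurable_comp hg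
      exact ⟨g', hg', hgK⟩
  have hmA : Measurable (A.indicator (1 : ℝ → ℝ≥0∞)) := measurable_one.indicator hA
  have e1 : ∀ A : Set ℝ, MeasurableSet A →
      γ ((fun p : Path N × Path N => proj N t p.2) ⁻¹' B ∩ (fun p => coord N t p.1) ⁻¹' A)
      = ∫⁻ x, g (proj N t x) * A.indicator 1 (coord N t x) ∂μ := by
    intro A hA
    have hset : ((fun p : Path N × Path N => proj N t p.2) ⁻¹' B
        ∩ (fun p => coord N t p.1) ⁻¹' A) = (coord N t ⁻¹' A) ×ˢ (proj N t ⁻¹' B) := by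
      ext p; simp [and_comm]
    rw [hset]
    conv_lhs => rw [← hK]
    rw [Measure.compProd_apply_prod (measurable_coord N t hA) (measurable_proj N t hB),
      ← lintegral_indicator (measurable_coord N t hA)]
    refine lintegral_congr_ae ?_
    filter_upwards [hgK] with x hx
    by_cases hxA : coord N t x ∈ A
    · rw [indicator_of_mem (by exact hxA), hx]; simp [hxA]
    · rw [indicator_of_notMem (by exact hxA)]; simp [hxA]
  have e2 : ∀ A : Set ℝ, MeasurableSet A →
      ∫⁻ x, g (proj N t x) * A.indicator 1 (coord N t x) ∂μ
      = (∫⁻ x, g (proj N t x) ∂μ) * μ (coord N t ⁻¹' A) := by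
    intro A hA
    have hmA : Measurable (A.indicator (1 : ℝ → ℝ≥0∞)) := measurable_one.indicator hA
    rw [lintegral_indep μ _ _ (measurable_proj N t) (measurable_coord N t) hind
      (fun q => g q.1 * A.indicator 1 q.2) (by fun_prop)]
    simp_rw [lintegral_const_mul _ hmA, lintegral_indicator_one hA]
    rw [lintegral_mul_const _ (f := fun x => g (proj N t x)) (hg.comp (measurable_proj N t)),
      Measure.map_apply (measurable_coord N t) hA]
  have e3 : γ ((fun p : Path N × Path N => proj N t p.2) ⁻¹' B) = ∫⁻ x, g (proj N t x) ∂μ := by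
    have := (e1 univ MeasurableSet.univ).trans (e2 univ MeasurableSet.univ)
    simpa using this
  have e4 : γ ((fun p : Path N × Path N => coord N t p.1) ⁻¹' A) = μ (coord N t ⁻¹' A) := by
    conv_rhs => rw [← h.1.1]
    rw [Measure.map_apply measurable_fst (measurable_coord N t hA)]
    rfl
  rw [e1 A hA, e2 A hA, e3, e4]

/-! ### Gluing one-step kernels that only depend on the past of the second path -/

/-- Law of the pair of prefixes generated by the kernels `κ`. -/
def glueM (κ : ∀ t : ℕ, Kernel (Fin t → ℝ) (ℝ × ℝ)) :
    ∀ t : ℕ, Measure ((Fin t → ℝ) × (Fin t → ℝ))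
  | 0 => Measure.dirac (Fin.elim0, Fin.elim0)
  | t + 1 => ((glueM κ t) ⊗ₘ ((κ t).comap Prod.snd measurable_snd)).map
      (fun q => (snocFun t q.1.1 q.2.1, snocFun t q.1.2 q.2.2))

lemma measurable_snoc2 (t : ℕ) :
    Measurable (fun q : ((Fin t → ℝ) × (Fin t → ℝ)) × ℝ × ℝ =>
      (snocFun t q.1.1 q.2.1, snocFun t q.1.2 q.2.2)) := by
  refine Measurable.prodMk ?_ ?_
  · exact (measurable_snocFun t).comp ((measurable_fst.comp measurable_fst).prodMk
      (measurable_fst.comp measurable_snd))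
  · exact (measurable_snocFun t).comp ((measurable_snd.comp measurable_fst).prodMk
      (measurable_snd.comp measurable_snd))

lemma glueM_prob (κ : ∀ t : ℕ, Kernel (Fin t → ℝ) (ℝ × ℝ)) [∀ t, IsMarkovKernel (κ t)] (t : ℕ) :
    IsProbabilityMeasure (glueM κ t) := by
  induction t with
  | zero => unfold glueM; infer_instance
  | succ t ih =>
    unfold glueM
    exact Measure.isProbabilityMeasure_map (measurable_snoc2 t).aemeasurable

lemma glueM_succ (κ : ∀ t : ℕ, Kernel (Fin t → ℝ) (ℝ × ℝ)) [∀ t, IsMarkovKernel (κ t)] (t : ℕ)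
    (G : (Fin (t + 1) → ℝ) × (Fin (t + 1) → ℝ) → ℝ≥0∞) (hG : Measurable G) :
    ∫⁻ z, G z ∂(glueM κ (t + 1))
      = ∫⁻ z, ∫⁻ q, G (snocFun t z.1 q.1, snocFun t z.2 q.2) ∂(κ t z.2) ∂(glueM κ t) := by
  have := glueM_prob κ t
  rw [glueM, lintegral_map hG (measurable_snoc2 t),
    Measure.lintegral_compProd (f := fun q : ((Fin t → ℝ) × (Fin t → ℝ)) × ℝ × ℝ =>
      G (snocFun t q.1.1 q.2.1, snocFun t q.1.2 q.2.2)) (hG.comp (measurable_snoc2 t))]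
  rfl

lemma measurable_proj2 (s t : ℕ) : Measurable (fun z : (Fin s → ℝ) × (Fin s → ℝ) =>
    (proj s t z.1, proj s t z.2)) :=
  ((measurable_proj s t).comp measurable_fst).prodMk ((measurable_proj s t).comp measurable_snd)

lemma glueM_trunc_one (κ : ∀ t : ℕ, Kernel (Fin t → ℝ) (ℝ × ℝ)) [∀ t, IsMarkovKernel (κ t)]
    (t : ℕ) (H : (Fin t → ℝ) × (Fin t → ℝ) → ℝ≥0∞) (hH : Measurable H) :
    ∫⁻ z, H (proj (t + 1) t z.1, proj (t + 1) t z.2) ∂(glueM κ (t + 1))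
      = ∫⁻ z, H z ∂(glueM κ t) := by
  rw [glueM_succ κ t (fun z => H (proj (t + 1) t z.1, proj (t + 1) t z.2))
    (hH.comp (measurable_proj2 (t + 1) t))]
  simp [proj_snocFun le_rfl, proj_self]

lemma glueM_trunc (κ : ∀ t : ℕ, Kernel (Fin t → ℝ) (ℝ × ℝ)) [∀ t, IsMarkovKernel (κ t)]
    (t s : ℕ) (hts : t ≤ s) (H : (Fin t → ℝ) × (Fin t → ℝ) → ℝ≥0∞) (hH : Measurable H) :
    ∫⁻ z, H (proj s t z.1, proj s t z.2) ∂(glueM κ s) = ∫⁻ z, H z ∂(glueM κ t) := by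
  induction s, hts using Nat.le_induction with
  | base => simp [proj_self]
  | succ s hts ih =>
    rw [← ih, ← glueM_trunc_one κ s (fun z => H (proj s t z.1, proj s t z.2))
      (hH.comp (measurable_proj2 s t))]
    simp [proj_proj hts]

lemma glueM_step (κ : ∀ t : ℕ, Kernel (Fin t → ℝ) (ℝ × ℝ)) [∀ t, IsMarkovKernel (κ t)]
    (t N : ℕ) (ht : t < N) (F : ((Fin t → ℝ) × (Fin t → ℝ)) × ℝ × ℝ → ℝ≥0∞) (hF : Measurable F) :
    ∫⁻ p, F ((proj N t p.1, proj N t p.2), coord N t p.1, coord N t p.2) ∂(glueM κ N)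
      = ∫⁻ p, ∫⁻ q, F ((proj N t p.1, proj N t p.2), q) ∂(κ t (proj N t p.2)) ∂(glueM κ N) := by
  have hm : ∀ s : ℕ, Measurable (fun p : (Fin s → ℝ) × (Fin s → ℝ) =>
      F ((proj s t p.1, proj s t p.2), coord s t p.1, coord s t p.2)) := fun s =>
    hF.comp ((measurable_proj2 s t).prodMk (((measurable_coord s t).comp measurable_fst).prodMk
      ((measurable_coord s t).comp measurable_snd)))
  have e1 := glueM_trunc κ (t + 1) N ht _ (hm (t + 1))
  simp only [proj_proj (Nat.le_succ t), coord_proj (Nat.lt_succ_self t)] at e1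
  rw [e1, glueM_succ κ t _ (hm (t + 1))]
  have e2 := glueM_trunc κ t N ht.le (fun z => ∫⁻ q, F (z, q) ∂(κ t z.2))
    (Measurable.lintegral_kernel_prod_right' (κ := (κ t).comap Prod.snd measurable_snd) hF)
  rw [e2]
  simp [proj_snocFun le_rfl, proj_self, coord_snocFun]

/-- One-step conditional law of the pair given the past of the second path. -/
def pairK (N : ℕ) (γ : Measure (Path N × Path N)) [IsFiniteMeasure γ] (t : ℕ) :
    Kernel (Fin t → ℝ) (ℝ × ℝ) :=
  (γ.map (fun p => (proj N t p.2, (coord N t p.1, coord N t p.2)))).condKernel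

instance (N : ℕ) (γ : Measure (Path N × Path N)) [IsFiniteMeasure γ] (t : ℕ) :
    IsMarkovKernel (pairK N γ t) := by unfold pairK; infer_instance

instance (N : ℕ) (μ : Measure (Path N)) [IsFiniteMeasure μ] (t : ℕ) :
    IsMarkovKernel (nextK N μ t) := by unfold nextK; infer_instance

lemma pairK_disint {N : ℕ} {μ ν : Measure (Path N)} {γ : Measure (Path N × Path N)}
    [IsFiniteMeasure γ] (hc : IsCoupling μ ν γ) (t : ℕ)
    (F : (Fin t → ℝ) × ℝ × ℝ → ℝ≥0∞) (hF : Measurable F) :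
    ∫⁻ p, F (proj N t p.2, coord N t p.1, coord N t p.2) ∂γ
      = ∫⁻ y, ∫⁻ q, F (proj N t y, q) ∂(pairK N γ t (proj N t y)) ∂ν := by
  have h := disint_condKernel γ (fun p => proj N t p.2)
    (fun p => (coord N t p.1, coord N t p.2))
    ((measurable_proj N t).comp measurable_snd)
    (((measurable_coord N t).comp measurable_fst).prodMk
      ((measurable_coord N t).comp measurable_snd)) F hF
  rw [h, ← hc.2, lintegral_map _ measurable_snd]
  · rfl
  · exact (Measurable.lintegral_kernel_prod_right' hF).comp (measurable_proj N t)

lemma nextK_disint {N : ℕ} (μ : Measure (Path N)) [IsFiniteMeasure μ] :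
    IsDisint N (nextK N μ) μ := by
  intro t _ F hF
  exact disint_condKernel μ _ _ (measurable_proj N t) (measurable_coord N t) F hF

lemma pairK_fst_ae {N : ℕ} {μ ν : Measure (Path N)} [IsProbabilityMeasure μ]
    [IsProbabilityMeasure ν] {γ : Measure (Path N × Path N)} [IsProbabilityMeasure γ]
    (hc : IsCausal N μ ν γ) (t : ℕ) (ht : t < N)
    (hind : IndepFun (proj N t) (coord N t) μ) :
    ∀ᵐ y ∂ν, (pairK N γ t (proj N t y)).map Prod.fst = μ.map (coord N t) := by
  have : IsProbabilityMeasure (μ.map (coord N t)) :=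
    Measure.isProbabilityMeasure_map (measurable_coord N t).aemeasurable
  have hi := hc.indep t ht hind
  have key := kernel_ae_unique ν (proj N t) (measurable_proj N t) (pairK N γ t).fst
    (Kernel.const _ (μ.map (coord N t))) ?_
  · filter_upwards [key] with y hy
    rw [Kernel.fst_apply, Kernel.const_apply] at hy
    exact hy
  · intro F hF
    have hF' : Measurable (fun q : (Fin t → ℝ) × ℝ × ℝ => F (q.1, q.2.1)) := by fun_prop
    have e1 := pairK_disint hc.1 t (fun q => F (q.1, q.2.1)) hF'
    have e2 : ∀ y : Path N, ∫⁻ b, F (proj N t y, b) ∂((pairK N γ t).fst (proj N t y))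
        = ∫⁻ q, F (proj N t y, q.1) ∂(pairK N γ t (proj N t y)) := by
      intro y
      rw [Kernel.lintegral_fst _ _ (by fun_prop)]
    simp_rw [e2, Kernel.const_apply]
    rw [← e1]
    have e3 := lintegral_indep γ _ _ ((measurable_proj N t).comp measurable_snd)
      ((measurable_coord N t).comp measurable_fst) hi F hF
    have e4 : γ.map (coord N t ∘ Prod.fst) = μ.map (coord N t) := by
      rw [← Measure.map_map (measurable_coord N t) measurable_fst, hc.1.1]
    rw [e4] at e3
    simp only [Function.comp_apply] at e3
    rw [e3, ← hc.1.2, lintegral_map _ measurable_snd]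
    exact (hF.lintegral_prod_right').comp (measurable_proj N t)

lemma pairK_snd_disint {N : ℕ} {μ ν : Measure (Path N)} {γ : Measure (Path N × Path N)}
    [IsFiniteMeasure γ] (hc : IsCoupling μ ν γ) :
    IsDisint N (fun t => (pairK N γ t).snd) ν := by
  intro t _ F hF
  have hF' : Measurable (fun q : (Fin t → ℝ) × ℝ × ℝ => F (q.1, q.2.2)) := by fun_prop
  have e1 := pairK_disint hc t (fun q => F (q.1, q.2.2)) hF'
  have e2 : ∀ y : Path N, ∫⁻ b, F (proj N t y, b) ∂((pairK N γ t).snd (proj N t y))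
      = ∫⁻ q, F (proj N t y, q.2) ∂(pairK N γ t (proj N t y)) := by
    intro y
    rw [Kernel.lintegral_snd _ _ (by fun_prop)]
  simp_rw [e2]
  rw [← e1, ← hc.2, lintegral_map _ measurable_snd]
  exact hF.comp ((measurable_proj N t).prodMk (measurable_coord N t))

lemma pairK_snd_ae {N : ℕ} {μ ν : Measure (Path N)}
    [IsProbabilityMeasure ν] {γ : Measure (Path N × Path N)} [IsProbabilityMeasure γ]
    (hc : IsCoupling μ ν γ) (t : ℕ) (ht : t < N) :
    ∀ᵐ y ∂ν, (pairK N γ t (proj N t y)).map Prod.snd = nextK N ν t (proj N t y) := by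
  have key := kernel_ae_unique ν (proj N t) (measurable_proj N t) (pairK N γ t).snd
    (nextK N ν t) ?_
  · filter_upwards [key] with y hy
    rw [Kernel.snd_apply] at hy
    exact hy
  · intro F hF
    rw [← pairK_snd_disint hc t ht F hF, ← nextK_disint ν t ht F hF]

lemma const_disint {N : ℕ} {μ : Measure (Path N)} [IsProbabilityMeasure μ]
    (hind : ∀ t, t < N → IndepFun (proj N t) (coord N t) μ) :
    IsDisint N (fun t => Kernel.const _ (μ.map (coord N t))) μ := by
  intro t ht F hF
  exact lintegral_indep μ _ _ (measurable_proj N t) (measurable_coord N t) (hind t ht) F hF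

lemma nextK_ae {N : ℕ} {μ : Measure (Path N)} [IsProbabilityMeasure μ]
    (hind : ∀ t, t < N → IndepFun (proj N t) (coord N t) μ) (t : ℕ) (ht : t < N) :
    ∀ᵐ x ∂μ, nextK N μ t (proj N t x) = μ.map (coord N t) := by
  have : IsProbabilityMeasure (μ.map (coord N t)) :=
    Measure.isProbabilityMeasure_map (measurable_coord N t).aemeasurable
  have key := kernel_ae_unique μ (proj N t) (measurable_proj N t) (nextK N μ t)
    (Kernel.const _ (μ.map (coord N t))) ?_
  · filter_upwards [key] with y hy
    rw [hy, Kernel.const_apply]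
  · intro F hF
    rw [← const_disint hind t ht F hF, ← nextK_disint μ t ht F hF]

/-- Every causal plan from a product measure can be replaced by a bicausal one with the same
laws of the pairs of coordinates. -/
lemma exists_bicausal {N : ℕ} {μ ν : Measure (Path N)} [IsProbabilityMeasure μ]
    [IsProbabilityMeasure ν] {γ : Measure (Path N × Path N)}
    (hind : ∀ t, t < N → IndepFun (proj N t) (coord N t) μ)
    (hc : IsCausal N μ ν γ) :
    ∃ γ' : Measure (Path N × Path N), IsBicausal N μ ν γ' ∧
      ∀ t, t < N → ∀ F : ℝ × ℝ → ℝ≥0∞, Measurable F →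
        ∫⁻ p, F (coord N t p.1, coord N t p.2) ∂γ' = ∫⁻ p, F (coord N t p.1, coord N t p.2) ∂γ := by
  have hγ : IsProbabilityMeasure γ := hc.1.isProb
  set γ' : Measure (Path N × Path N) := glueM (pairK N γ) N with hγ'def
  have hγ' : IsProbabilityMeasure γ' := glueM_prob _ N
  have hγs : IsProbabilityMeasure (γ'.map Prod.swap) :=
    Measure.isProbabilityMeasure_map measurable_swap.aemeasurable
  have hprobk : ∀ t, IsProbabilityMeasure (μ.map (coord N t)) := fun t =>
    Measure.isProbabilityMeasure_map (measurable_coord N t).aemeasurable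
  have hstep := fun t (ht : t < N) => glueM_step (pairK N γ) t N ht
  -- second coordinate
  have hS2 : IsStep N (fun t => (pairK N γ t).snd) (γ'.map Prod.swap) := by
    intro t ht F hF
    have hF' : Measurable (fun q : ((Fin t → ℝ) × (Fin t → ℝ)) × ℝ × ℝ =>
        F (q.1.2, q.1.1, q.2.2)) := by fun_prop
    have e1 := hstep t ht _ hF'
    rw [lintegral_map _ measurable_swap, lintegral_map _ measurable_swap]
    · simp only [Prod.fst_swap, Prod.snd_swap]
      rw [e1]
      refine lintegral_congr fun p => ?_
      rw [Kernel.lintegral_snd _ _ (by fun_prop)]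
    · refine Measurable.lintegral_kernel_prod_right'
        (κ := (pairK N γ t).snd.comap (fun p : Path N × Path N => proj N t p.1)
          ((measurable_proj N t).comp measurable_fst))
        (f := fun q : (Path N × Path N) × ℝ => F (proj N t q.1.1, proj N t q.1.2, q.2)) ?_
      refine hF.comp (((measurable_proj N t).comp (measurable_fst.comp measurable_fst)).prodMk
        (((measurable_proj N t).comp (measurable_snd.comp measurable_fst)).prodMk measurable_snd))
    · exact hF.comp (((measurable_proj N t).comp measurable_fst).prodMk
        (((measurable_proj N t).comp measurable_snd).prodMk
          ((measurable_coord N t).comp measurable_fst)))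
  have hm2 : γ'.map Prod.snd = ν := by
    have := hS2.map_fst (pairK_snd_disint hc.1)
    rwa [Measure.map_map measurable_fst measurable_swap] at this
  -- first coordinate
  have hS1 : IsStep N (fun t => Kernel.const _ (μ.map (coord N t))) γ' := by
    intro t ht F hF
    have hF' : Measurable (fun q : ((Fin t → ℝ) × (Fin t → ℝ)) × ℝ × ℝ =>
        F (q.1.1, q.1.2, q.2.1)) := by fun_prop
    have e1 := hstep t ht _ hF'
    rw [e1]
    have hae := pairK_fst_ae hc t ht (hind t ht)
    rw [← hm2] at hae
    refine lintegral_congr_ae ?_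
    filter_upwards [ae_of_ae_map measurable_snd.aemeasurable hae] with p hp
    rw [Kernel.const_apply, ← hp, lintegral_map (by fun_prop) measurable_fst]
  have hm1 : γ'.map Prod.fst = μ := hS1.map_fst (const_disint hind)
  refine ⟨γ', ⟨hS1.isCausal ⟨hm1, hm2⟩, hS2.isCausal ⟨?_, ?_⟩⟩, ?_⟩
  · rw [Measure.map_map measurable_fst measurable_swap]; exact hm2
  · rw [Measure.map_map measurable_snd measurable_swap]; exact hm1
  · intro t ht F hF
    have e1 := hstep t ht (fun q => F q.2) (by fun_prop)
    have e2 := pairK_disint hc.1 t (fun q => F q.2) (by fun_prop)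
    simp only at e1 e2
    rw [e1, e2, ← hm2, lintegral_map _ measurable_snd]
    refine (Measurable.lintegral_kernel_prod_right' (κ := pairK N γ t)
      (f := fun q => F q.2) (by fun_prop)).comp (measurable_proj N t)

/-! ### The Knothe–Rosenblatt coupling -/

/-- Extension of a path to a sequence. -/
def ext0 (N : ℕ) (u : Path N) : ℕ → ℝ := fun n => if h : n < N then u ⟨n, h⟩ else 0

lemma measurable_ext0 (N n : ℕ) : Measurable (fun u : Path N => ext0 N u n) :=
  measurable_coord N n

lemma krPartial_congr (N : ℕ) (μ : Measure (Path N)) [IsFiniteMeasure μ] (u v : ℕ → ℝ) (t : ℕ)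
    (h : ∀ n, n < t → u n = v n) : krPartial N μ u t = krPartial N μ v t := by
  induction t with
  | zero => rfl
  | succ t ih =>
    unfold krPartial
    rw [ih fun n hn => h n (by omega), h t (by omega)]

lemma measurable_krPartial {α : Type*} [MeasurableSpace α] (N : ℕ) (μ : Measure (Path N))
    [IsFiniteMeasure μ] (u : α → ℕ → ℝ) (hu : ∀ n, Measurable fun a => u a n) (t : ℕ) :
    Measurable (fun a => krPartial N μ (u a) t) := by
  induction t with
  | zero => unfold krPartial; exact measurable_const
  | succ t ih =>
    unfold krPartial
    exact (measurable_snocFun t).comp (ih.prodMk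
      ((measurable_qinv_kernel (nextK N μ t)).comp (ih.prodMk (hu t))))

lemma proj_krPartial (N : ℕ) (μ : Measure (Path N)) [IsFiniteMeasure μ] (u : ℕ → ℝ) (t s : ℕ)
    (hts : t ≤ s) : proj s t (krPartial N μ u s) = krPartial N μ u t := by
  induction s, hts using Nat.le_induction with
  | base => exact proj_self _
  | succ s hts ih =>
    rw [krPartial, proj_snocFun hts, ih]

lemma proj_krPath (N : ℕ) (μ : Measure (Path N)) [IsFiniteMeasure μ] (u : Path N) (t : ℕ)
    (ht : t ≤ N) : proj N t (krPath N μ u) = krPartial N μ (ext0 N u) t :=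
  proj_krPartial N μ _ t N ht

lemma coord_krPath (N : ℕ) (μ : Measure (Path N)) [IsFiniteMeasure μ] (u : Path N) (t : ℕ)
    (ht : t < N) : coord N t (krPath N μ u)
      = qinv (nextK N μ t (krPartial N μ (ext0 N u) t)) (coord N t u) := by
  rw [← coord_proj (Nat.lt_succ_self t) (krPath N μ u), proj_krPath N μ u (t + 1) ht, krPartial,
    coord_snocFun]
  rfl

lemma measurable_krPath (N : ℕ) (μ : Measure (Path N)) [IsFiniteMeasure μ] :
    Measurable (krPath N μ) :=
  measurable_krPartial N μ (fun u => ext0 N u) (measurable_ext0 N) N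

lemma krPartial_ext0 (N : ℕ) (μ : Measure (Path N)) [IsFiniteMeasure μ] (u : Path N) (t : ℕ)
    (ht : t ≤ N) : krPartial N μ (ext0 N u) t = krPartial N μ (ext0 t (proj N t u)) t := by
  refine krPartial_congr N μ _ _ t fun n hn => ?_
  have : n < N := by omega
  simp [ext0, proj, hn, this]

lemma measurable_krPair (N : ℕ) (μ ν : Measure (Path N)) [IsFiniteMeasure μ] [IsFiniteMeasure ν] :
    Measurable (fun u => (krPath N μ u, krPath N ν u)) :=
  (measurable_krPath N μ).prodMk (measurable_krPath N ν)

instance (N : ℕ) (μ ν : Measure (Path N)) [IsFiniteMeasure μ] [IsFiniteMeasure ν] :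
    IsProbabilityMeasure (krCoupling N μ ν) :=
  Measure.isProbabilityMeasure_map (measurable_krPair N μ ν).aemeasurable

lemma uniformCube_coord (N t : ℕ) (ht : t < N) : (uniformCube N).map (coord N t) = unif01 := by
  have := (measurePreserving_eval (μ := fun _ : Fin N => unif01) ⟨t, ht⟩).map_eq
  have h2 : coord N t = Function.eval (⟨t, ht⟩ : Fin N) := by
    funext x; simp [coord, ht]
  rw [h2]; exact this

lemma kr_step (N : ℕ) (μ ν : Measure (Path N)) [IsFiniteMeasure μ] [IsFiniteMeasure ν]
    (t : ℕ) (ht : t < N) (F : ((Fin t → ℝ) × (Fin t → ℝ)) × ℝ × ℝ → ℝ≥0∞) (hF : Measurable F) :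
    ∫⁻ p, F ((proj N t p.1, proj N t p.2), coord N t p.1, coord N t p.2) ∂(krCoupling N μ ν)
      = ∫⁻ p, ∫⁻ v, F ((proj N t p.1, proj N t p.2), qinv (nextK N μ t (proj N t p.1)) v,
          qinv (nextK N ν t (proj N t p.2)) v) ∂unif01 ∂(krCoupling N μ ν) := by
  have hG : Measurable (fun q : ((Fin t → ℝ) × (Fin t → ℝ)) × ℝ =>
      F (q.1, qinv (nextK N μ t q.1.1) q.2, qinv (nextK N ν t q.1.2) q.2)) := by
    refine hF.comp (measurable_fst.prodMk (Measurable.prodMk ?_ ?_))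
    · exact (measurable_qinv_kernel (nextK N μ t)).comp
        ((measurable_fst.comp measurable_fst).prodMk measurable_snd)
    · exact (measurable_qinv_kernel (nextK N ν t)).comp
        ((measurable_snd.comp measurable_fst).prodMk measurable_snd)
  have hΦ : Measurable (fun z : Fin t → ℝ =>
      (krPartial N μ (ext0 t z) t, krPartial N ν (ext0 t z) t)) :=
    (measurable_krPartial N μ _ (measurable_ext0 t) t).prodMk
      (measurable_krPartial N ν _ (measurable_ext0 t) t)
  rw [krCoupling, lintegral_map _ (measurable_krPair N μ ν),
    lintegral_map _ (measurable_krPair N μ ν)]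
  · simp only [proj_krPath N μ _ t ht.le, proj_krPath N ν _ t ht.le, coord_krPath N μ _ t ht,
      coord_krPath N ν _ t ht, krPartial_ext0 N μ _ t ht.le, krPartial_ext0 N ν _ t ht.le]
    have := lintegral_indep (uniformCube N) (proj N t) (coord N t) (measurable_proj N t)
      (measurable_coord N t) (pi_indep N t ht _)
      (fun q => F ((krPartial N μ (ext0 t q.1) t, krPartial N ν (ext0 t q.1) t),
        qinv (nextK N μ t (krPartial N μ (ext0 t q.1) t)) q.2,
        qinv (nextK N ν t (krPartial N ν (ext0 t q.1) t)) q.2))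
      (hG.comp ((hΦ.comp measurable_fst).prodMk measurable_snd))
    rw [uniformCube_coord N t ht] at this
    exact this
  · exact (hG.lintegral_prod_right').comp (measurable_proj2 N t)
  · exact hF.comp ((measurable_proj2 N t).prodMk (((measurable_coord N t).comp
      measurable_fst).prodMk ((measurable_coord N t).comp measurable_snd)))

lemma kr_isStep (N : ℕ) (μ ν : Measure (Path N)) [IsFiniteMeasure μ] [IsFiniteMeasure ν] :
    IsStep N (nextK N μ) (krCoupling N μ ν) := by
  intro t ht F hF
  have e1 := kr_step N μ ν t ht (fun q => F (q.1.1, q.1.2, q.2.1)) (by fun_prop)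
  simp only at e1
  rw [e1]
  refine lintegral_congr fun p => ?_
  conv_rhs => rw [← map_qinv (nextK N μ t (proj N t p.1))]
  rw [lintegral_map (by fun_prop) (measurable_qinv _)]

lemma kr_swap (N : ℕ) (μ ν : Measure (Path N)) [IsFiniteMeasure μ] [IsFiniteMeasure ν] :
    (krCoupling N μ ν).map Prod.swap = krCoupling N ν μ := by
  rw [krCoupling, Measure.map_map measurable_swap (measurable_krPair N μ ν)]
  rfl

lemma kr_coupling (N : ℕ) (μ ν : Measure (Path N)) [IsProbabilityMeasure μ]
    [IsProbabilityMeasure ν] : IsCoupling μ ν (krCoupling N μ ν) := by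
  refine ⟨(kr_isStep N μ ν).map_fst (nextK_disint μ), ?_⟩
  have := (kr_isStep N ν μ).map_fst (nextK_disint ν)
  rwa [← kr_swap, Measure.map_map measurable_fst measurable_swap] at this

lemma kr_causal (N : ℕ) (μ ν : Measure (Path N)) [IsProbabilityMeasure μ]
    [IsProbabilityMeasure ν] : IsCausal N μ ν (krCoupling N μ ν) :=
  (kr_isStep N μ ν).isCausal (kr_coupling N μ ν)

lemma transfer_snd {N : ℕ} {μ ν : Measure (Path N)} {γ : Measure (Path N × Path N)}
    (hc : IsCoupling μ ν γ) {Ψ : Path N → ℝ≥0∞} (hΨ : Measurable Ψ) :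
    ∫⁻ y, Ψ y ∂ν = ∫⁻ p, Ψ p.2 ∂γ := by
  rw [← hc.2, lintegral_map hΨ measurable_snd]

lemma kr_optimal_step {N : ℕ} {μ ν : Measure (Path N)} [IsProbabilityMeasure μ]
    [IsProbabilityMeasure ν] {γ : Measure (Path N × Path N)}
    (hind : ∀ t, t < N → IndepFun (proj N t) (coord N t) μ)
    (hc : IsCausal N μ ν γ) (t : ℕ) (ht : t < N) (h : ℝ → ℝ) (hconv : ConvexOn ℝ univ h) :
    ∫⁻ p, ENNReal.ofReal (h (coord N t p.1 - coord N t p.2)) ∂(krCoupling N μ ν)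
      ≤ ∫⁻ p, ENNReal.ofReal (h (coord N t p.1 - coord N t p.2)) ∂γ := by
  have hγ : IsProbabilityMeasure γ := hc.1.isProb
  have hμt : IsProbabilityMeasure (μ.map (coord N t)) :=
    Measure.isProbabilityMeasure_map (measurable_coord N t).aemeasurable
  have hhm : Measurable h := (continuousOn_univ.1 (hconv.continuousOn isOpen_univ)).measurable
  have hkr := kr_coupling N μ ν
  have e1 := kr_step N μ ν t ht (fun q => ENNReal.ofReal (h (q.2.1 - q.2.2))) (by fun_prop)
  have e2 := pairK_disint hc.1 t (fun q => ENNReal.ofReal (h (q.2.1 - q.2.2))) (by fun_prop)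
  simp only at e1 e2
  rw [e1, e2]
  have hae1 := nextK_ae hind t ht
  conv at hae1 => enter [2]; rw [← hkr.1]
  have e3 : ∫⁻ p, ∫⁻ v, ENNReal.ofReal (h (qinv (nextK N μ t (proj N t p.1)) v
        - qinv (nextK N ν t (proj N t p.2)) v)) ∂unif01 ∂(krCoupling N μ ν)
      = ∫⁻ y, ∫⁻ v, ENNReal.ofReal (h (qinv (μ.map (coord N t)) v
        - qinv (nextK N ν t (proj N t y)) v)) ∂unif01 ∂ν := by
    rw [transfer_snd hkr]
    · refine lintegral_congr_ae ?_
      filter_upwards [ae_of_ae_map measurable_fst.aemeasurable hae1] with p hp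
      rw [hp]
    · have hq : Measurable (fun q : Path N × ℝ => ENNReal.ofReal (h (qinv (μ.map (coord N t)) q.2
          - qinv (nextK N ν t (proj N t q.1)) q.2))) := by
        refine ENNReal.measurable_ofReal.comp (hhm.comp (Measurable.sub ?_ ?_))
        · exact (measurable_qinv _).comp measurable_snd
        · exact (measurable_qinv_kernel (nextK N ν t)).comp
            (((measurable_proj N t).comp measurable_fst).prodMk measurable_snd)
      exact hq.lintegral_prod_right'
  rw [e3]
  refine lintegral_mono_ae ?_
  filter_upwards [pairK_fst_ae hc t ht (hind t ht), pairK_snd_ae hc.1 t ht] with y h1 h2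
  exact comono_convex (pairK N γ t (proj N t y)) _ _ (measurable_qinv _) (measurable_qinv _)
    (qinv_monotoneOn _) (qinv_monotoneOn _) (by rw [h1, map_qinv]) (by rw [h2, map_qinv]) h hconv

/-! ### The Knothe–Rosenblatt Monge map -/

lemma measurable_krMapPartial (N : ℕ) (μ ν : Measure (Path N)) [IsFiniteMeasure μ]
    [IsFiniteMeasure ν] (t : ℕ) : Measurable (fun x => krMapPartial N μ ν x t) := by
  induction t with
  | zero => unfold krMapPartial; exact measurable_const
  | succ t ih =>
    unfold krMapPartial
    exact (measurable_snocFun t).comp (ih.prodMk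
      ((measurable_qinv_kernel (nextK N ν t)).comp (ih.prodMk
        ((measurable_cdf1_kernel (nextK N μ t)).comp
          ((measurable_proj N t).prodMk (measurable_coord N t))))))

lemma kr_monge (N : ℕ) (μ ν : Measure (Path N)) [IsProbabilityMeasure μ]
    [IsProbabilityMeasure ν] (hind : ∀ t, t < N → IndepFun (proj N t) (coord N t) μ)
    (hat : ∀ t, t < N → ∀ r, μ.map (coord N t) {r} = 0) :
    krCoupling N μ ν = μ.map (fun x => (x, krMap N μ ν x)) := by
  have hkr := kr_coupling N μ ν
  have hX : (uniformCube N).map (krPath N μ) = μ := by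
    have := hkr.1
    rwa [krCoupling, Measure.map_map measurable_fst (measurable_krPair N μ ν)] at this
  have hmeas : Measurable (fun x => (x, krMap N μ ν x)) :=
    measurable_id.prodMk (measurable_krMapPartial N μ ν N)
  have hae : ∀ᵐ u ∂(uniformCube N), ∀ t, t < N →
      cdf1 (nextK N μ t (proj N t (krPath N μ u))) (coord N t (krPath N μ u)) = coord N t u := by
    rw [ae_all_iff]
    intro t
    by_cases ht : t < N
    · have hμt : IsProbabilityMeasure (μ.map (coord N t)) :=
        Measure.isProbabilityMeasure_map (measurable_coord N t).aemeasurable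
      have h1 := nextK_ae hind t ht
      conv at h1 => enter [2]; rw [← hX]
      have h1 := ae_of_ae_map (measurable_krPath N μ).aemeasurable h1
      have h2 := unif01_ae
      rw [← uniformCube_coord N t ht] at h2
      have h2 := ae_of_ae_map (measurable_coord N t).aemeasurable h2
      filter_upwards [h1, h2] with u hu1 hu2 _
      rw [coord_krPath N μ u t ht, ← proj_krPath N μ u t ht.le, hu1]
      exact cdf1_qinv _ (hat t ht) hu2
    · exact ae_of_all _ fun u h => absurd h ht
  have e := Measure.map_map (μ := uniformCube N) hmeas (measurable_krPath N μ)
  rw [hX] at e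
  rw [e, krCoupling]
  refine Measure.map_congr ?_
  filter_upwards [hae] with u hu
  have key : ∀ t, t ≤ N → krMapPartial N μ ν (krPath N μ u) t = krPartial N ν (ext0 N u) t := by
    intro t
    induction t with
    | zero => intro _; rfl
    | succ t ih =>
      intro ht
      rw [krMapPartial, krPartial, ih (by omega), hu t ht]
      rfl
  exact Prod.ext rfl (key N le_rfl).symm

theorem product_source_causal_equals_bicausal_and_KR_optimal
    (N : ℕ) (μ ν : Measure (Path N)) [IsProbabilityMeasure μ] [IsProbabilityMeasure ν]
    (hprod : μ = Measure.pi (fun i : Fin N => μ.map (fun x => x i)))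
    (c : Fin N → ℝ → ℝ → ℝ≥0∞)
    (hlsc : ∀ i, LowerSemicontinuous (fun q : ℝ × ℝ => c i q.1 q.2)) :
    ((⨅ (γ : Measure (Path N × Path N)) (_ : IsCausal N μ ν γ),
        ∫⁻ p, ∑ i, c i (p.1 i) (p.2 i) ∂γ)
      = ⨅ (γ : Measure (Path N × Path N)) (_ : IsBicausal N μ ν γ),
          ∫⁻ p, ∑ i, c i (p.1 i) (p.2 i) ∂γ)
    ∧ (∀ h : Fin N → ℝ → ℝ, (∀ i, ConvexOn ℝ Set.univ (h i)) →
        (∀ (i : Fin N) (x y : ℝ), c i x y = ENNReal.ofReal (h i (x - y))) →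
        (IsCausal N μ ν (krCoupling N μ ν)
          ∧ ∫⁻ p, ∑ i, c i (p.1 i) (p.2 i) ∂(krCoupling N μ ν)
              = ⨅ (γ : Measure (Path N × Path N)) (_ : IsCausal N μ ν γ),
                  ∫⁻ p, ∑ i, c i (p.1 i) (p.2 i) ∂γ)
        ∧ ((∀ (i : Fin N) (r : ℝ), μ.map (fun x => x i) {r} = 0) →
            krCoupling N μ ν = μ.map (fun x => (x, krMap N μ ν x)))) := by
  have hpm : ∀ i : Fin N, IsProbabilityMeasure (μ.map (fun x => x i)) := fun i =>
    Measure.isProbabilityMeasure_map (measurable_pi_apply i).aemeasurable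
  have hind : ∀ t, t < N → IndepFun (proj N t) (coord N t) μ := by
    intro t ht
    have := pi_indep N t ht (fun i => μ.map (fun x => x i))
    rwa [← hprod] at this
  have hcm : ∀ i, Measurable (fun q : ℝ × ℝ => c i q.1 q.2) := fun i => (hlsc i).measurable
  have hcost : ∀ γ : Measure (Path N × Path N), ∫⁻ p, ∑ i, c i (p.1 i) (p.2 i) ∂γ
      = ∑ i : Fin N, ∫⁻ p, c i (coord N i p.1) (coord N i p.2) ∂γ := by
    intro γ
    rw [lintegral_finsetSum]
    · simp only [coord_eq]
    · intro i _
      have hm : Measurable (fun p : Path N × Path N => (p.1 i, p.2 i)) := by fun_prop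
      exact (hcm i).comp hm
  refine ⟨le_antisymm ?_ ?_, fun h hconv hch => ⟨⟨kr_causal N μ ν, le_antisymm ?_ ?_⟩, ?_⟩⟩
  · exact le_iInf₂ fun γ hγ => iInf₂_le γ hγ.1
  · refine le_iInf₂ fun γ hγ => ?_
    obtain ⟨γ', hb, he⟩ := exists_bicausal hind hγ
    refine (iInf₂_le γ' hb).trans (le_of_eq ?_)
    rw [hcost, hcost]
    exact Finset.sum_congr rfl fun i _ => he i i.2 (fun q => c i q.1 q.2) (hcm i)
  · refine le_iInf₂ fun γ hγ => ?_
    rw [hcost, hcost]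
    simp only [hch]
    exact Finset.sum_le_sum fun i _ => kr_optimal_step hind hγ i i.2 (h i) (hconv i)
  · exact iInf₂_le _ (kr_causal N μ ν)
  · intro hat
    refine kr_monge N μ ν hind fun t ht r => ?_
    have : coord N t = fun x => x ⟨t, ht⟩ := by funext x; simp [coord, ht]
    rw [this]
    exact hat _ r

end CausalTransport
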